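/- There is a constant C, depending only on n, with the following property (boundedness of the maximal regularity operator T on H¹_z). Let a be a (1,∞)-atom supported in a parabolic ball Q contained in X = (0,∞) × ℝⁿ, and define u(t,x) = ∫_0^t ∫_{ℝⁿ} p_{t−s}(x−y) a(s,y) dy ds. Then there exists g ∈ H¹_z(X) with ‖g‖_{H¹_z(X)} ≤ C such that for almost every t > 0, g(t,·) equals the distributional Laplacian in x of u(t,·). -/

import Mathlib

open MeasureTheory Metric Filter Set

noncomputable section

/-- The parabolic quasi-distance on `ℝ × E`. -/
def pdist {E : Type*} [MetricSpace E] (p q : ℝ × E) : ℝ :=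
  max (Real.sqrt |p.1 - q.1|) (dist p.2 q.2)

/-- The open parabolic ball in `N = ℝ × E`. -/
def pball {E : Type*} [MetricSpace E] (c : ℝ × E) (r : ℝ) : Set (ℝ × E) :=
  {p | pdist p c < r}

/-- The upper half space `X = (0,∞) × E` of `N = ℝ × E`. -/
def Xset (E : Type*) : Set (ℝ × E) := {p | 0 < p.1}

/-- The product measure `ν = Lebesgue ⊗ μ` on `N = ℝ × E`. -/
def pmeas {E : Type*} [MeasurableSpace E] (μ : Measure E) : Measure (ℝ × E) :=
  (volume : Measure ℝ).prod μ

/-- A `(1,2)`-atom on `N`: supported in a parabolic ball `Q`, mean value zero, and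
`‖a‖_{L²(ν)} ≤ ν(Q)^{-1/2}`. -/
def IsAtom12 {E : Type*} [MetricSpace E] [MeasurableSpace E]
    (μ : Measure E) (a : ℝ × E → ℝ) : Prop :=
  ∃ (c : ℝ × E) (r : ℝ), 0 < r ∧ Function.support a ⊆ pball c r ∧
    Integrable a (pmeas μ) ∧ (∫ p, a p ∂(pmeas μ)) = 0 ∧
    eLpNorm a 2 (pmeas μ) ≤ (pmeas μ (pball c r)) ^ (-(1:ℝ)/2)

/-- `f = Σ λ_i a_i` with convergence in `L¹(ρ)`. -/
def HasL1Decomp {E : Type*} [MeasurableSpace E] (ρ : Measure (ℝ × E))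
    (f : ℝ × E → ℝ) (lam : ℕ → ℝ) (a : ℕ → ℝ × E → ℝ) : Prop :=
  Summable (fun i => |lam i|) ∧
  Tendsto (fun k => eLpNorm (fun p => f p - ∑ i ∈ Finset.range k, lam i * a i p) 1 ρ)
    atTop (nhds 0)

/-- Membership in the atomic Hardy space `H¹(N)`. -/
def MemH1 {E : Type*} [MetricSpace E] [MeasurableSpace E]
    (μ : Measure E) (f : ℝ × E → ℝ) : Prop :=
  Integrable f (pmeas μ) ∧
  ∃ (lam : ℕ → ℝ) (a : ℕ → ℝ × E → ℝ), (∀ i, IsAtom12 μ (a i)) ∧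
    HasL1Decomp (pmeas μ) f lam a

/-- The `H¹(N)` norm: infimum of `Σ |λ_i|` over all atomic decompositions. -/
def H1norm {E : Type*} [MetricSpace E] [MeasurableSpace E]
    (μ : Measure E) (f : ℝ × E → ℝ) : ℝ :=
  sInf {c | ∃ (lam : ℕ → ℝ) (a : ℕ → ℝ × E → ℝ), (∀ i, IsAtom12 μ (a i)) ∧
    HasL1Decomp (pmeas μ) f lam a ∧ c = ∑' i, |lam i|}

/-- Membership in `H¹_r(X)`: `f ∈ L¹(X,ν)` is the restriction to `X` of some `F ∈ H¹(N)`. -/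
def MemH1r {E : Type*} [MetricSpace E] [MeasurableSpace E]
    (μ : Measure E) (f : ℝ × E → ℝ) : Prop :=
  IntegrableOn f (Xset E) (pmeas μ) ∧
  ∃ F : ℝ × E → ℝ, MemH1 μ F ∧ F =ᵐ[(pmeas μ).restrict (Xset E)] f

/-- The quotient norm on `H¹_r(X)`. -/
def H1rnorm {E : Type*} [MetricSpace E] [MeasurableSpace E]
    (μ : Measure E) (f : ℝ × E → ℝ) : ℝ :=
  sInf {c | ∃ F : ℝ × E → ℝ, MemH1 μ F ∧ F =ᵐ[(pmeas μ).restrict (Xset E)] f ∧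
    c = H1norm μ F}

/-- Membership in `H¹_z(X)`: the extension of `f` by zero belongs to `H¹(N)`. -/
def MemH1z {E : Type*} [MetricSpace E] [MeasurableSpace E]
    (μ : Measure E) (f : ℝ × E → ℝ) : Prop :=
  IntegrableOn f (Xset E) (pmeas μ) ∧ MemH1 μ ((Xset E).indicator f)

/-- The `H¹_z(X)` norm: the `H¹(N)` norm of the zero extension. -/
def H1znorm {E : Type*} [MetricSpace E] [MeasurableSpace E]
    (μ : Measure E) (f : ℝ × E → ℝ) : ℝ :=
  H1norm μ ((Xset E).indicator f)

/-- The Gauss–Weierstrass heat kernel `p_t(z) = (4πt)^{−n/2} exp(−|z|²/(4t))` on `ℝⁿ`. -/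
def heatKernel (n : ℕ) (t : ℝ) (z : EuclideanSpace ℝ (Fin n)) : ℝ :=
  (4 * Real.pi * t) ^ (-(n : ℝ) / 2) * Real.exp (-‖z‖ ^ 2 / (4 * t))

/-- A `(1,∞)`-atom supported in the parabolic ball `pball c r ⊆ X = (0,∞) × ℝⁿ`. -/
def IsAtom1Inf (n : ℕ) (a : ℝ × EuclideanSpace ℝ (Fin n) → ℝ)
    (c : ℝ × EuclideanSpace ℝ (Fin n)) (r : ℝ) : Prop :=
  0 < r ∧ Function.support a ⊆ pball c r ∧
    pball c r ⊆ Xset (EuclideanSpace ℝ (Fin n)) ∧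
    Integrable a (pmeas volume) ∧ (∫ p, a p ∂(pmeas volume)) = 0 ∧
    eLpNorm a ⊤ (pmeas volume) ≤ (pmeas volume (pball c r))⁻¹

/-- The Laplacian of `φ : ℝⁿ → ℝ` as the sum of its second partial derivatives. -/
def lapl {n : ℕ} (φ : EuclideanSpace ℝ (Fin n) → ℝ) (x : EuclideanSpace ℝ (Fin n)) : ℝ :=
  ∑ i : Fin n,
    iteratedFDeriv ℝ 2 φ x ![EuclideanSpace.single i 1, EuclideanSpace.single i 1]

/-- Euclidean `n`-space. -/
abbrev Euc (n : ℕ) : Type := EuclideanSpace ℝ (Fin n)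

theorem pball_eq_prod {E : Type*} [MetricSpace E] (c : ℝ × E) {r : ℝ} (hr : 0 < r) :
    pball c r = ball c.1 (r ^ 2) ×ˢ ball c.2 r := by
  ext p
  simp only [pball, pdist, mem_ofPred_eq, max_lt_iff, mem_prod, mem_ball, Real.dist_eq]
  rw [Real.sqrt_lt' hr]

theorem measurableSet_pball {n : ℕ} (c : ℝ × Euc n) {r : ℝ} (hr : 0 < r) :
    MeasurableSet (pball c r) := by
  rw [pball_eq_prod c hr]
  exact measurableSet_ball.prod measurableSet_ball

/-- The volume of the unit parabolic ball. -/
def unitVol (n : ℕ) : ℝ := 2 * (volume (ball (0 : Euc n) 1)).toReal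

theorem unitVol_pos (n : ℕ) : 0 < unitVol n := by
  have h1 : 0 < volume (ball (0 : Euc n) 1) := measure_ball_pos _ _ one_pos
  have h2 : volume (ball (0 : Euc n) 1) < ⊤ := measure_ball_lt_top
  have := ENNReal.toReal_pos h1.ne' h2.ne
  unfold unitVol; positivity

theorem pmeas_pball {n : ℕ} (c : ℝ × Euc n) {r : ℝ} (hr : 0 < r) :
    pmeas volume (pball c r) = ENNReal.ofReal (unitVol n * r ^ (n + 2)) := by
  have h2 : volume (ball (0 : Euc n) 1) < ⊤ := measure_ball_lt_top
  rw [pball_eq_prod c hr, pmeas, Measure.prod_prod, Real.volume_ball,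
    Measure.addHaar_ball_of_pos _ _ hr, finrank_euclideanSpace_fin,
    ← ENNReal.ofReal_toReal h2.ne, ← ENNReal.ofReal_mul (by positivity),
    ← ENNReal.ofReal_mul (by positivity)]
  congr 1
  unfold unitVol
  ring

/-- A series of suitably normalised cancelling pieces converging in `L¹` gives an atomic
decomposition. -/
theorem memH1_of_tendsto {n : ℕ} {f : ℝ × Euc n → ℝ} (hf : Integrable f (pmeas volume))
    (h : ℕ → ℝ × Euc n → ℝ) (lam : ℕ → ℝ) (c : ℕ → ℝ × Euc n) (r : ℕ → ℝ)
    (hlam : ∀ k, 0 < lam k) (hsum : Summable lam) (hr : ∀ k, 0 < r k)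
    (hsupp : ∀ k, Function.support (h k) ⊆ pball (c k) (r k))
    (hint : ∀ k, Integrable (h k) (pmeas volume)) (hzero : ∀ k, ∫ p, h k p ∂(pmeas volume) = 0)
    (hnorm : ∀ k, eLpNorm (h k) 2 (pmeas volume) ≤
      ENNReal.ofReal (lam k) * (pmeas volume (pball (c k) (r k))) ^ (-(1 : ℝ) / 2))
    (hlim : Tendsto (fun k => eLpNorm (fun p => f p - ∑ i ∈ Finset.range k, h i p) 1
      (pmeas volume)) atTop (nhds 0)) :
    MemH1 volume f ∧ H1norm volume f ≤ ∑' k, lam k := by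
  have key : ∃ (a : ℕ → ℝ × Euc n → ℝ), (∀ i, IsAtom12 volume (a i)) ∧
      HasL1Decomp (pmeas volume) f lam a := by
    refine ⟨fun k => (lam k)⁻¹ • h k, fun k => ⟨c k, r k, hr k, ?_, ?_, ?_, ?_⟩, ?_, ?_⟩
    · exact (Function.support_const_smul_subset _ _).trans (hsupp k)
    · exact (hint k).smul _
    · simp [integral_const_mul, hzero k]
    · rw [eLpNorm_const_smul, Real.enorm_of_nonneg (inv_nonneg.2 (hlam k).le),
        ENNReal.ofReal_inv_of_pos (hlam k)]
      have h0 : ENNReal.ofReal (lam k) ≠ 0 := by simpa using hlam k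
      calc _ ≤ (ENNReal.ofReal (lam k))⁻¹ * (ENNReal.ofReal (lam k) *
          (pmeas volume (pball (c k) (r k))) ^ (-(1 : ℝ) / 2)) := by gcongr; exact hnorm k
        _ = _ := by rw [← mul_assoc, ENNReal.inv_mul_cancel h0 ENNReal.ofReal_ne_top, one_mul]
    · simpa [abs_of_pos (hlam _)] using hsum
    · have : ∀ i p, lam i * ((lam i)⁻¹ • h i) p = h i p := fun i p => by
        simp [mul_inv_cancel_left₀ (hlam i).ne']
      simpa only [this] using hlim
  obtain ⟨a, ha, hd⟩ := key
  refine ⟨⟨hf, lam, a, ha, hd⟩, csInf_le ⟨0, ?_⟩ ⟨lam, a, ha, hd, ?_⟩⟩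
  · rintro _ ⟨l, _, _, _, rfl⟩
    exact tsum_nonneg fun _ => abs_nonneg _
  · simp [abs_of_pos (hlam _)]

theorem eLpNorm_two_le_of_bound {n : ℕ} {h : ℝ × Euc n → ℝ} {c : ℝ × Euc n} {r D : ℝ}
    (hr : 0 < r) (hsupp : Function.support h ⊆ pball c r)
    (hb : ∀ᵐ p ∂(pmeas volume), |h p| ≤ D / (unitVol n * r ^ (n + 2))) :
    eLpNorm h 2 (pmeas volume) ≤
      ENNReal.ofReal D * (pmeas volume (pball c r)) ^ (-(1 : ℝ) / 2) := by
  have hv : 0 < unitVol n * r ^ (n + 2) := mul_pos (unitVol_pos n) (by positivity)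
  set v := unitVol n * r ^ (n + 2) with hvdef
  have h1 : eLpNorm h 2 (pmeas volume) ≤
      eLpNorm ((pball c r).indicator fun _ => D / v) 2 (pmeas volume) := by
    apply eLpNorm_mono_ae
    filter_upwards [hb] with p hp
    by_cases hpB : p ∈ pball c r
    · rw [indicator_of_mem hpB, Real.norm_eq_abs, Real.norm_eq_abs]
      exact hp.trans (le_abs_self _)
    · have : h p = 0 := by
        by_contra h0
        exact hpB (hsupp h0)
      simp [this]
  refine h1.trans ?_
  rw [eLpNorm_indicator_const (measurableSet_pball c hr) two_ne_zero ENNReal.ofNat_ne_top,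
    pmeas_pball c hr, ENNReal.ofReal_rpow_of_pos hv, ENNReal.ofReal_rpow_of_pos hv]
  rcases le_or_gt 0 D with hD | hD
  · rw [Real.enorm_of_nonneg (by positivity), ← ENNReal.ofReal_mul (by positivity),
      ← ENNReal.ofReal_mul hD]
    apply ENNReal.ofReal_le_ofReal
    rw [div_mul_eq_mul_div, div_eq_mul_inv, mul_assoc, ← Real.rpow_neg_one, ← Real.rpow_add hv]
    norm_num
  · exfalso
    have : NeZero (pmeas (volume : Measure (Euc n))) := ⟨fun h0 => by
      have := pmeas_pball c hr
      rw [h0] at this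
      simp only [Measure.coe_zero, Pi.zero_apply] at this
      exact absurd this.symm (by simpa using hv)⟩
    obtain ⟨p, hp⟩ := hb.exists
    exact absurd ((abs_nonneg _).trans hp) (not_le.2 (div_neg_of_neg_of_pos hD hv))

/-- `L²` size together with parabolic decay of order `n + 3` off a ball. -/
structure IsMolecule {n : ℕ} (f : ℝ × Euc n → ℝ) (c : ℝ × Euc n) (r A : ℝ) : Prop where
  meas : AEStronglyMeasurable f (pmeas volume)
  r_pos : 0 < r
  A_pos : 0 < A
  norm_le : eLpNorm f 2 (pmeas volume) ≤
    ENNReal.ofReal A * (pmeas volume (pball c r)) ^ (-(1 : ℝ) / 2)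
  decay : ∀ᵐ p ∂(pmeas volume), 4 * r ≤ pdist p c → |f p| ≤ A * r / pdist p c ^ (n + 3)

theorem pball_mono {E : Type*} [MetricSpace E] (c : ℝ × E) {r s : ℝ} (h : r ≤ s) :
    pball c r ⊆ pball c s := fun _ hp => lt_of_lt_of_le hp h

namespace IsMolecule

variable {n : ℕ} {f : ℝ × Euc n → ℝ} {c : ℝ × Euc n} {r A : ℝ}

theorem lintegral_tail_le (hf : IsMolecule f c r A) (k : ℕ) :
    ∫⁻ p in (pball c (2 ^ (k + 2) * r))ᶜ, ‖f p‖ₑ ∂(pmeas volume) ≤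
      ENNReal.ofReal (unitVol n * 2 ^ (n + 1) * A * (1 / 2) ^ k) := by
  have hr := hf.r_pos
  have hA := hf.A_pos
  have hκ := unitVol_pos n
  have hρ : ∀ j : ℕ, 0 < 2 ^ (j + 2) * r := fun j => by positivity
  set S : ℕ → Set (ℝ × Euc n) := fun i =>
    pball c (2 ^ (k + i + 1 + 2) * r) \ pball c (2 ^ (k + i + 2) * r)
  have hcover : (pball c (2 ^ (k + 2) * r))ᶜ ⊆ ⋃ i, S i := by
    intro p hp
    have hex : ∃ i : ℕ, p ∈ pball c (2 ^ (k + i + 2) * r) := by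
      obtain ⟨i, hi⟩ := pow_unbounded_of_one_lt (pdist p c / r) (one_lt_two)
      refine ⟨i, ?_⟩
      have h1 : (2 : ℝ) ^ i ≤ 2 ^ (k + i + 2) := pow_le_pow_right₀ one_le_two (by omega)
      rw [div_lt_iff₀ hr] at hi
      exact hi.trans_le (by gcongr)
    classical
    have hspec := Nat.find_spec hex
    have hmin := fun m => Nat.find_min hex (m := m)
    set i := Nat.find hex
    have hi0 : i ≠ 0 := by
      intro h0
      rw [h0] at hspec
      exact hp hspec
    obtain ⟨j, hj⟩ := Nat.exists_eq_succ_of_ne_zero hi0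
    refine mem_iUnion.2 ⟨j, ?_, hmin j (by omega)⟩
    rw [hj] at hspec
    exact hspec
  have hS : ∀ i, ∫⁻ p in S i, ‖f p‖ₑ ∂(pmeas volume) ≤
      ENNReal.ofReal (unitVol n * 2 ^ n * A * (1 / 2) ^ k * (1 / 2) ^ i) := by
    intro i
    have hρi := hρ (k + i)
    set ρ := 2 ^ (k + i + 2) * r with hρdef
    have hSm : MeasurableSet (S i) :=
      (measurableSet_pball c (hρ _)).diff (measurableSet_pball c (hρ _))
    calc ∫⁻ p in S i, ‖f p‖ₑ ∂(pmeas volume)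
        ≤ ∫⁻ p in S i, ENNReal.ofReal (A * r / ρ ^ (n + 3)) ∂(pmeas volume) := by
          apply lintegral_mono_ae
          rw [ae_restrict_iff' hSm]
          filter_upwards [hf.decay] with p hp hpS
          have hge : ρ ≤ pdist p c := not_lt.1 hpS.2
          have h4 : 4 * r ≤ ρ := by
            rw [hρdef, pow_add]
            have : (1 : ℝ) ≤ 2 ^ (k + i) := one_le_pow₀ one_le_two
            nlinarith
          rw [Real.enorm_eq_ofReal_abs]
          apply ENNReal.ofReal_le_ofReal
          refine (hp (h4.trans hge)).trans ?_
          gcongr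
      _ ≤ ENNReal.ofReal (A * r / ρ ^ (n + 3)) *
            pmeas volume (pball c (2 ^ (k + i + 1 + 2) * r)) := by
          rw [setLIntegral_const]
          gcongr
          exact sdiff_subset
      _ = _ := by
          rw [pmeas_pball c (hρ _), ← ENNReal.ofReal_mul (by positivity)]
          congr 1
          have : (2 : ℝ) ^ (k + i + 1 + 2) * r = 2 * ρ := by rw [hρdef]; ring
          rw [this]
          have h3 : (1 / 2 : ℝ) ^ k * (1 / 2) ^ i = 4 * r / ρ := by
            rw [hρdef]
            rw [← pow_add, one_div_pow, pow_add 2 (k + i) 2]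
            field_simp
            norm_num
          clear_value ρ
          rw [mul_assoc _ _ ((1 / 2 : ℝ) ^ i), h3, mul_pow, pow_succ ρ (n + 2)]
          field_simp
          ring
  calc _ ≤ ∫⁻ p in ⋃ i, S i, ‖f p‖ₑ ∂(pmeas volume) := lintegral_mono_set hcover
    _ ≤ ∑' i, ∫⁻ p in S i, ‖f p‖ₑ ∂(pmeas volume) := lintegral_iUnion_le _ _
    _ ≤ ∑' i, ENNReal.ofReal (unitVol n * 2 ^ n * A * (1 / 2) ^ k * (1 / 2) ^ i) :=
        ENNReal.tsum_le_tsum hS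
    _ = _ := by
        rw [← ENNReal.ofReal_tsum_of_nonneg (fun i => by positivity)
          (summable_geometric_two.mul_left _), tsum_mul_left, tsum_geometric_two]
        congr 1
        ring

theorem integrable (hf : IsMolecule f c r A) : Integrable f (pmeas volume) := by
  have hr := hf.r_pos
  have hB : 0 < (2 : ℝ) ^ (0 + 2) * r := by positivity
  have hm := measurableSet_pball c hB
  rw [← integrableOn_univ, ← union_compl_self (pball c (2 ^ (0 + 2) * r)), integrableOn_union]
  constructor
  · have : IsFiniteMeasure ((pmeas volume).restrict (pball c (2 ^ (0 + 2) * r))) :=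
      ⟨by rw [Measure.restrict_apply_univ, pmeas_pball c hB]; exact ENNReal.ofReal_lt_top⟩
    have h2 : MemLp f 2 (pmeas volume) := by
      refine ⟨hf.meas, hf.norm_le.trans_lt ?_⟩
      rw [pmeas_pball c hr, ENNReal.ofReal_rpow_of_pos
        (mul_pos (unitVol_pos n) (by have := hf.r_pos; positivity))]
      exact ENNReal.mul_lt_top ENNReal.ofReal_lt_top ENNReal.ofReal_lt_top
    exact (h2.restrict _).integrable one_le_two
  · exact ⟨hf.meas.restrict, (hf.lintegral_tail_le 0).trans_lt ENNReal.ofReal_lt_top⟩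

/-- The constant in the atomic norm of a molecule. -/
def molConst (n : ℕ) : ℝ := unitVol n * 2 ^ (2 * n + 6) + 2 ^ (n + 2)

theorem molConst_pos (n : ℕ) : 0 < molConst n := by
  have := unitVol_pos n
  unfold molConst; positivity

theorem memH1 (hf : IsMolecule f c r A) (h0 : ∫ p, f p ∂(pmeas volume) = 0) :
    MemH1 volume f ∧ H1norm volume f ≤ 4 * molConst n * A := by
  have hr := hf.r_pos
  have hA := hf.A_pos
  have hκ := unitVol_pos n
  have hint := hf.integrable
  set κ := unitVol n with hκdef
  set ρ : ℕ → ℝ := fun k => 2 ^ (k + 2) * r with hρdef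
  have hρ : ∀ k, 0 < ρ k := fun k => by simp only [hρdef]; positivity
  have hρs : ∀ k, ρ (k + 1) = 2 * ρ k := fun k => by simp only [hρdef]; ring
  have hmono : ∀ k, pball c (ρ k) ⊆ pball c (ρ (k + 1)) := fun k =>
    pball_mono c (by rw [hρs]; linarith [hρ k])
  set v : ℕ → ℝ := fun k => κ * ρ k ^ (n + 2) with hvdef
  have hv : ∀ k, 0 < v k := fun k => mul_pos hκ (pow_pos (hρ k) _)
  have hvs : ∀ k, v (k + 1) = 2 ^ (n + 2) * v k := fun k => by
    simp only [hvdef, hρs, mul_pow]; ring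
  have hν : ∀ k, pmeas volume (pball c (ρ k)) = ENNReal.ofReal (v k) := fun k =>
    pmeas_pball c (hρ k)
  have hm : ∀ k, MeasurableSet (pball c (ρ k)) := fun k => measurableSet_pball c (hρ k)
  set T : ℕ → ℝ := fun k => κ * 2 ^ (n + 1) * A * (1 / 2) ^ k with hT
  have hTpos : ∀ k, 0 < T k := fun k => by simp only [hT]; positivity
  have htail : ∀ k, ∫⁻ p in (pball c (ρ k))ᶜ, ‖f p‖ₑ ∂(pmeas volume) ≤ ENNReal.ofReal (T k) :=
    hf.lintegral_tail_le
  set m : ℕ → ℝ := fun k => ∫ p in pball c (ρ k), f p ∂(pmeas volume) with hmdef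
  have hmT : ∀ k, |m k| ≤ T k := by
    intro k
    have h1 : m k = -∫ p in (pball c (ρ k))ᶜ, f p ∂(pmeas volume) := by
      have := integral_add_compl (hm k) hint
      rw [h0] at this
      exact eq_neg_of_add_eq_zero_left this
    rw [h1, abs_neg, ← Real.norm_eq_abs]
    refine (norm_integral_le_lintegral_norm _).trans ?_
    apply ENNReal.toReal_le_of_le_ofReal (hTpos k).le
    simpa only [ofReal_norm] using htail k
  set F : ℕ → ℝ × Euc n → ℝ := fun k => (pball c (ρ k)).indicator fun p => f p - m k / v k with hF
  have hFint : ∀ k, Integrable (F k) (pmeas volume) := by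
    intro k
    rw [integrable_indicator_iff (hm k)]
    refine hint.integrableOn.sub ?_
    rw [integrableOn_const_iff]
    right
    rw [hν k]
    exact ENNReal.ofReal_lt_top
  have hFzero : ∀ k, ∫ p, F k p ∂(pmeas volume) = 0 := by
    intro k
    have hc : IntegrableOn (fun _ : ℝ × Euc n => m k / v k) (pball c (ρ k)) (pmeas volume) := by
      rw [integrableOn_const_iff]
      right
      rw [hν k]
      exact ENNReal.ofReal_lt_top
    rw [integral_indicator (hm k), integral_sub hint.integrableOn hc, setIntegral_const,
      Measure.real, hν k, ENNReal.toReal_ofReal (hv k).le, smul_eq_mul,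
      mul_div_cancel₀ _ (hv k).ne']
    exact sub_self _
  have hFsupp : ∀ k, Function.support (F k) ⊆ pball c (ρ k) := fun k =>
    support_indicator_subset
  set h : ℕ → ℝ × Euc n → ℝ := fun k => Nat.casesOn k (F 0) fun k => F (k + 1) - F k with hh
  have hsum : ∀ k, ∀ p, ∑ i ∈ Finset.range (k + 1), h i p = F k p := by
    intro k p
    induction k with
    | zero => simp [hh]
    | succ k ih => rw [Finset.sum_range_succ, ih]; simp [hh]
  set lam : ℕ → ℝ := fun k => 2 * molConst n * A * (1 / 2) ^ k with hlam
  have hK := molConst_pos n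
  have hmain := memH1_of_tendsto hint h lam (fun _ => c) ρ
    (fun k => by simp only [hlam]; positivity)
    (summable_geometric_two.mul_left _) hρ ?_ ?_ ?_ ?_ ?_
  · refine ⟨hmain.1, hmain.2.trans (le_of_eq ?_)⟩
    simp only [hlam]
    rw [tsum_mul_left, tsum_geometric_two]
    ring
  · rintro (_ | k)
    · exact hFsupp 0
    · exact (Function.support_sub _ _).trans
        (union_subset (hFsupp _) ((hFsupp k).trans (hmono k)))
  · rintro (_ | k)
    · exact hFint 0
    · exact (hFint _).sub (hFint _)
  · rintro (_ | k)
    · exact hFzero 0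
    · change ∫ p, (F (k + 1) p - F k p) ∂(pmeas volume) = 0
      rw [integral_sub (hFint _) (hFint _), hFzero, hFzero, sub_zero]
  · rintro (_ | k)
    · have hc : Function.support ((pball c (ρ 0)).indicator fun _ => m 0 / v 0) ⊆ pball c (ρ 0) :=
        support_indicator_subset
      have h1 : h 0 = (pball c (ρ 0)).indicator f -
          (pball c (ρ 0)).indicator fun _ => m 0 / v 0 := by
        rw [← indicator_sub']; rfl
      have h2 : eLpNorm ((pball c (ρ 0)).indicator fun _ => m 0 / v 0) 2 (pmeas volume) ≤
          ENNReal.ofReal (T 0) * (pmeas volume (pball c (ρ 0))) ^ (-(1 : ℝ) / 2) := by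
        refine eLpNorm_two_le_of_bound (hρ 0) hc (Eventually.of_forall fun p => ?_)
        change _ ≤ T 0 / v 0
        by_cases hp : p ∈ pball c (ρ 0)
        · rw [indicator_of_mem hp, abs_div, abs_of_pos (hv 0)]
          exact div_le_div_of_nonneg_right (hmT 0) (hv 0).le
        · rw [indicator_of_notMem hp, abs_zero]
          exact div_nonneg (hTpos 0).le (hv 0).le
      have hw : 0 < κ * r ^ (n + 2) := by positivity
      have h3 : (κ * r ^ (n + 2)) ^ (-(1 : ℝ) / 2) = 2 ^ (n + 2) * (v 0) ^ (-(1 : ℝ) / 2) := by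
        have hv0 : v 0 = ((2 : ℝ) ^ (n + 2)) ^ 2 * (κ * r ^ (n + 2)) := by
          simp only [hvdef, hρdef, zero_add, mul_pow]
          rw [← pow_mul, ← pow_mul, mul_comm 2 (n + 2)]
          ring
        have h4 : (((2 : ℝ) ^ (n + 2)) ^ 2) ^ (-(1 : ℝ) / 2) = ((2 : ℝ) ^ (n + 2))⁻¹ := by
          rw [← Real.rpow_natCast _ 2, ← Real.rpow_mul (by positivity), ← Real.rpow_neg_one]
          norm_num
        rw [hv0, Real.mul_rpow (by positivity) hw.le, h4, mul_inv_cancel_left₀ (by positivity)]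
      rw [h1]
      calc _ ≤ eLpNorm ((pball c (ρ 0)).indicator f) 2 (pmeas volume) + _ :=
            eLpNorm_sub_le (hf.meas.indicator (hm 0))
              (aestronglyMeasurable_const.indicator (hm 0)) one_le_two
        _ ≤ ENNReal.ofReal A * (pmeas volume (pball c r)) ^ (-(1 : ℝ) / 2) +
            ENNReal.ofReal (T 0) * (pmeas volume (pball c (ρ 0))) ^ (-(1 : ℝ) / 2) :=
            add_le_add ((eLpNorm_indicator_le _).trans hf.norm_le) h2
        _ = ENNReal.ofReal ((A * 2 ^ (n + 2) + T 0) * (v 0) ^ (-(1 : ℝ) / 2)) := by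
            have hv0 := hv 0
            have hT0 := hTpos 0
            rw [hν 0, pmeas_pball c hr, ENNReal.ofReal_rpow_of_pos hw,
              ENNReal.ofReal_rpow_of_pos (hv 0), h3, ← ENNReal.ofReal_mul hA.le,
              ← ENNReal.ofReal_mul (hTpos 0).le, ← ENNReal.ofReal_add (by positivity)
              (by positivity)]
            congr 1
            ring
        _ ≤ ENNReal.ofReal (lam 0 * (v 0) ^ (-(1 : ℝ) / 2)) := by
            have hv0 := hv 0
            apply ENNReal.ofReal_le_ofReal
            gcongr
            simp only [hT, hlam, pow_zero, mul_one, molConst, ← hκdef]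
            have : (2 : ℝ) ^ (n + 1) ≤ 2 ^ (2 * n + 6) :=
              pow_le_pow_right₀ one_le_two (by omega)
            have h5 : κ * 2 ^ (n + 1) * A ≤ κ * 2 ^ (2 * n + 6) * A := by gcongr
            have h6 : 0 < κ * 2 ^ (2 * n + 6) * A := by positivity
            have h7 : 0 < A * 2 ^ (n + 2) := by positivity
            nlinarith
        _ = _ := by
            have hK' := hK.le
            rw [hν 0, ENNReal.ofReal_rpow_of_pos (hv 0), ENNReal.ofReal_mul
              (by simp only [hlam]; positivity)]
    · refine eLpNorm_two_le_of_bound (hρ (k + 1)) ((Function.support_sub _ _).trans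
        (union_subset (hFsupp _) ((hFsupp k).trans (hmono k)))) ?_
      change ∀ᵐ p ∂pmeas volume, |F (k + 1) p - F k p| ≤ lam (k + 1) / v (k + 1)
      have hvk := hv k
      have hvk1 := hv (k + 1)
      have hρk := hρ k
      set q : ℝ := κ * A * (1 / 2) ^ k with hq
      have hq0 : 0 < q := by positivity
      have hTk : T k = 2 ^ (n + 1) * q := by simp only [hT, hq]; ring
      have hTk1 : T (k + 1) = 2 ^ n * q := by simp only [hT, hq]; ring
      have hlamk : 2 ^ (2 * n + 6) * q ≤ lam (k + 1) := by
        simp only [hlam, molConst, ← hκdef, hq]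
        have : 0 < A * (1 / 2) ^ k * 2 ^ (n + 2) := by positivity
        rw [pow_succ (1 / 2 : ℝ) k]
        nlinarith
      have hm0 : |m k / v k| ≤ 2 ^ (2 * n + 3) * q / v (k + 1) := by
        rw [abs_div, abs_of_pos (hv k), hvs k]
        calc |m k| / v k ≤ T k / v k := div_le_div_of_nonneg_right (hmT k) (hv k).le
          _ = _ := by
            rw [hTk, show 2 * n + 3 = (n + 2) + (n + 1) by ring, pow_add]
            field_simp
            ring
      have hm1 : |m (k + 1) / v (k + 1)| ≤ 2 ^ n * q / v (k + 1) := by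
        rw [abs_div, abs_of_pos (hv (k + 1)), ← hTk1]
        exact div_le_div_of_nonneg_right (hmT (k + 1)) (hv (k + 1)).le
      have hp2 : (2 : ℝ) ^ n * q ≤ 2 ^ (2 * n + 3) * q := by
        gcongr
        · exact one_le_two
        · omega
      have hadd : 2 ^ (2 * n + 3) * q / v (k + 1) + 2 ^ (2 * n + 3) * q / v (k + 1) ≤
          lam (k + 1) / v (k + 1) := by
        rw [← add_div]
        gcongr
        refine le_trans ?_ hlamk
        rw [show 2 * n + 6 = (2 * n + 3) + 3 by ring, pow_add 2 (2 * n + 3) 3]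
        have : 0 < (2 : ℝ) ^ (2 * n + 3) * q := by positivity
        nlinarith
      have hm1' : |m (k + 1) / v (k + 1)| ≤ 2 ^ (2 * n + 3) * q / v (k + 1) :=
        hm1.trans (div_le_div_of_nonneg_right hp2 hvk1.le)
      filter_upwards [hf.decay] with p hp
      by_cases hpk : p ∈ pball c (ρ k)
      · rw [show F (k + 1) p = f p - m (k + 1) / v (k + 1) from
          indicator_of_mem (hmono k hpk) _,
          show F k p = f p - m k / v k from indicator_of_mem hpk _, sub_sub_sub_cancel_left]
        exact (abs_sub _ _).trans ((add_le_add hm0 hm1').trans hadd)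
      · rw [show F k p = 0 from indicator_of_notMem hpk _, sub_zero]
        by_cases hpk1 : p ∈ pball c (ρ (k + 1))
        · rw [show F (k + 1) p = f p - m (k + 1) / v (k + 1) from indicator_of_mem hpk1 _]
          have hge : ρ k ≤ pdist p c := not_lt.1 hpk
          have h4 : 4 * r ≤ ρ k := by
            simp only [hρdef]
            rw [pow_add]
            have : (1 : ℝ) ≤ 2 ^ k := one_le_pow₀ one_le_two
            nlinarith
          have hfp : |f p| ≤ 2 ^ (2 * n + 3) * q / v (k + 1) := by
            calc |f p| ≤ A * r / pdist p c ^ (n + 3) := hp (h4.trans hge)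
              _ ≤ A * r / ρ k ^ (n + 3) := by gcongr
              _ = 2 ^ n * q / v (k + 1) := by
                have h8 : (1 / 2 : ℝ) ^ k = 4 * r / ρ k := by
                  simp only [hρdef]
                  rw [one_div_pow, pow_add 2 k 2]
                  field_simp
                  norm_num
                rw [hvs, hq, h8]
                simp only [hvdef]
                clear_value ρ
                rw [pow_succ (ρ k) (n + 2)]
                field_simp
                ring
              _ ≤ _ := div_le_div_of_nonneg_right hp2 hvk1.le
          exact (abs_sub _ _).trans ((add_le_add hfp hm1').trans hadd)
        · rw [show F (k + 1) p = 0 from indicator_of_notMem hpk1 _, abs_zero]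
          exact div_nonneg (by simp only [hlam]; positivity) hvk1.le
  · rw [← tendsto_add_atTop_iff_nat 1]
    simp only [hsum]
    have hlim : Tendsto (fun k => ENNReal.ofReal (2 * T k)) atTop (nhds 0) := by
      rw [← ENNReal.ofReal_zero]
      apply ENNReal.tendsto_ofReal
      have := (tendsto_pow_atTop_nhds_zero_of_lt_one (r := (1 / 2 : ℝ)) (by norm_num)
        (by norm_num)).const_mul (2 * (κ * 2 ^ (n + 1) * A))
      simpa only [hT, mul_zero, mul_assoc] using this
    refine tendsto_of_tendsto_of_tendsto_of_le_of_le tendsto_const_nhds hlim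
      (fun _ => zero_le) fun k => ?_
    rw [eLpNorm_one_eq_lintegral_enorm, ← lintegral_add_compl _ (hm k), two_mul,
      ENNReal.ofReal_add (hTpos k).le (hTpos k).le]
    refine add_le_add ?_ ?_
    · calc _ = ∫⁻ p in pball c (ρ k), ENNReal.ofReal (|m k| / v k) ∂(pmeas volume) := by
            refine setLIntegral_congr_fun (hm k) fun p hp => ?_
            simp only [hF, indicator_of_mem hp, sub_sub_cancel]
            rw [Real.enorm_eq_ofReal_abs, abs_div, abs_of_pos (hv k)]
        _ = ENNReal.ofReal |m k| := by
            rw [setLIntegral_const, hν k, ← ENNReal.ofReal_mul (by have := hv k; positivity),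
              div_mul_cancel₀ _ (hv k).ne']
        _ ≤ _ := ENNReal.ofReal_le_ofReal (hmT k)
    · refine le_trans (le_of_eq ?_) (htail k)
      refine setLIntegral_congr_fun (hm k).compl fun p hp => ?_
      simp only [hF, indicator_of_notMem hp, sub_zero]

end IsMolecule

/-- The Laplacian (equivalently, the time derivative) of the heat kernel. -/
def lapKernel (n : ℕ) (t : ℝ) (z : Euc n) : ℝ :=
  heatKernel n t z * (‖z‖ ^ 2 / (4 * t ^ 2) - n / (2 * t))

theorem heatKernel_nonneg (n : ℕ) {t : ℝ} (ht : 0 ≤ t) (z : Euc n) : 0 ≤ heatKernel n t z := by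
  have := Real.pi_pos
  unfold heatKernel; positivity

theorem hasDerivAt_heatKernel_comp {n : ℕ} {T : ℝ → ℝ} {Z : ℝ → Euc n} {T' ρ' s : ℝ}
    (hT : HasDerivAt T T' s) (hpos : 0 < T s)
    (hZ : HasDerivAt (fun x => ‖Z x‖ ^ 2) ρ' s) :
    HasDerivAt (fun x => heatKernel n (T x) (Z x))
      (heatKernel n (T s) (Z s) *
        (-(n : ℝ) / 2 * (T' / T s) - (ρ' / (4 * T s) - ‖Z s‖ ^ 2 * T' / (4 * T s ^ 2)))) s := by
  have hπ := Real.pi_pos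
  have h1 := (hT.const_mul (4 * Real.pi)).rpow_const (p := -(n : ℝ) / 2)
    (Or.inl (by positivity))
  have h2 : HasDerivAt (fun x => Real.exp (-‖Z x‖ ^ 2 / (4 * T x)))
      (Real.exp (-‖Z s‖ ^ 2 / (4 * T s)) *
        ((-ρ' * (4 * T s) - (-‖Z s‖ ^ 2) * (4 * T')) / (4 * T s) ^ 2)) s :=
    (hZ.fun_neg.fun_div (hT.const_mul 4) (by positivity)).exp
  refine (h1.mul h2).congr_deriv ?_
  simp only [heatKernel]
  rw [Real.rpow_sub_one (by positivity)]
  field_simp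
  ring

theorem hasDerivAt_heatKernel {n : ℕ} {t : ℝ} (ht : 0 < t) (z : Euc n) :
    HasDerivAt (fun t => heatKernel n t z) (lapKernel n t z) t := by
  refine (hasDerivAt_heatKernel_comp (Z := fun _ => z) (hasDerivAt_id t) ht
    (hasDerivAt_const t (‖z‖ ^ 2))).congr_deriv ?_
  simp only [lapKernel, id]
  field_simp
  ring

theorem heatKernel_le {n : ℕ} {t : ℝ} (ht : 0 < t) (z : Euc n) :
    heatKernel n t z ≤ (√t ^ n)⁻¹ * Real.exp (-(‖z‖ ^ 2 / (4 * t))) := by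
  have hπ := Real.pi_gt_three
  have h1 : (4 * Real.pi * t) ^ (-(n : ℝ) / 2) ≤ t ^ (-(n : ℝ) / 2) := by
    apply Real.rpow_le_rpow_of_nonpos ht
    · nlinarith
    · have : (0 : ℝ) ≤ n := n.cast_nonneg
      linarith
  have h2 : t ^ (-(n : ℝ) / 2) = (√t ^ n)⁻¹ := by
    rw [← Real.rpow_natCast, Real.sqrt_eq_rpow, ← Real.rpow_mul ht.le, ← Real.rpow_neg ht.le]
    ring_nf
  have h3 : -‖z‖ ^ 2 / (4 * t) = -(‖z‖ ^ 2 / (4 * t)) := neg_div _ _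
  unfold heatKernel
  rw [← h2, h3]
  exact mul_le_mul_of_nonneg_right h1 (Real.exp_pos _).le

theorem exp_neg_mul_one_add_pow_le (m : ℕ) {v : ℝ} (hv : 0 ≤ v) :
    Real.exp (-v) * (1 + v) ^ m ≤ m.factorial * Real.exp 1 := by
  have := Real.pow_div_factorial_le_exp (1 + v) (by positivity) m
  rw [div_le_iff₀ (by positivity), Real.exp_add] at this
  have h2 := mul_le_mul_of_nonneg_left this (Real.exp_pos (-v)).le
  refine h2.trans (le_of_eq ?_)
  rw [show Real.exp (-v) * (Real.exp 1 * Real.exp v * m.factorial) =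
    (Real.exp (-v) * Real.exp v) * (m.factorial * Real.exp 1) by ring, ← Real.exp_add]
  simp

/-- A constant absorbing polynomial factors into Gaussian decay. -/
def gaussConst (n : ℕ) : ℝ := (n + 5).factorial * Real.exp 1

theorem gaussConst_pos (n : ℕ) : 0 < gaussConst n := by unfold gaussConst; positivity

theorem max_sqrt_norm_le {n : ℕ} {t : ℝ} (ht : 0 < t) (z : Euc n) :
    max √t ‖z‖ ≤ √t * (1 + ‖z‖ ^ 2 / (4 * t)) := by
  have hs := Real.sqrt_pos.2 ht
  apply max_le
  · have : 0 ≤ ‖z‖ ^ 2 / (4 * t) := by positivity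
    nlinarith
  · have hst : t = √t ^ 2 := (Real.sq_sqrt ht.le).symm
    set σ := √t
    rw [hst]
    have : σ * (1 + ‖z‖ ^ 2 / (4 * σ ^ 2)) - ‖z‖ = (‖z‖ - 2 * σ) ^ 2 / (4 * σ) := by
      field_simp
      ring
    have h2 : 0 ≤ (‖z‖ - 2 * σ) ^ 2 / (4 * σ) := by positivity
    linarith

theorem heatKernel_mul_sq_le {n : ℕ} {t : ℝ} (ht : 0 < t) (z : Euc n) {D : ℝ} (hD : 0 < D)
    (hDle : D ≤ max √t ‖z‖) :
    heatKernel n t z * (1 + ‖z‖ ^ 2 / (4 * t)) ^ 2 ≤ gaussConst n * √t ^ 3 / D ^ (n + 3) := by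
  have hs := Real.sqrt_pos.2 ht
  set v := ‖z‖ ^ 2 / (4 * t) with hv
  have hv0 : 0 ≤ v := by positivity
  have h1 := heatKernel_le ht z
  have h2 := exp_neg_mul_one_add_pow_le (n + 5) hv0
  have h3 : D ^ (n + 3) ≤ (√t * (1 + v)) ^ (n + 3) := by
    gcongr
    exact hDle.trans (max_sqrt_norm_le ht z)
  rw [le_div_iff₀ (by positivity)]
  calc _ ≤ ((√t ^ n)⁻¹ * Real.exp (-v)) * (1 + v) ^ 2 * (√t * (1 + v)) ^ (n + 3) := by gcongr
    _ = √t ^ 3 * (Real.exp (-v) * (1 + v) ^ (n + 5)) := by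
      rw [mul_pow]
      field_simp
      ring
    _ ≤ √t ^ 3 * gaussConst n := by gcongr; exact h2
    _ = _ := by ring

theorem abs_lapKernel_le_mul {n : ℕ} {t : ℝ} (ht : 0 < t) (z : Euc n) :
    |lapKernel n t z| ≤ (n + 1) / t * (heatKernel n t z * (1 + ‖z‖ ^ 2 / (4 * t))) := by
  have h0 := heatKernel_nonneg n ht.le z
  unfold lapKernel
  rw [abs_mul, abs_of_nonneg h0]
  have : ‖z‖ ^ 2 / (4 * t ^ 2) - n / (2 * t) = (‖z‖ ^ 2 / (4 * t) - n / 2) / t := by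
    field_simp
  rw [this, abs_div, abs_of_pos ht]
  set v := ‖z‖ ^ 2 / (4 * t) with hv
  have hv0 : 0 ≤ v := by positivity
  have hn : (0 : ℝ) ≤ n := n.cast_nonneg
  have h2 : |v - n / 2| ≤ (n + 1) * (1 + v) := by
    rw [abs_le]; constructor <;> nlinarith [mul_nonneg hn hv0]
  calc heatKernel n t z * (|v - n / 2| / t) ≤ heatKernel n t z * ((n + 1) * (1 + v) / t) := by
        gcongr
    _ = _ := by ring

theorem abs_lapKernel_le {n : ℕ} {t : ℝ} (ht : 0 < t) (z : Euc n) {D : ℝ} (hD : 0 < D)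
    (hDle : D ≤ max √t ‖z‖) :
    |lapKernel n t z| ≤ (n + 1) * gaussConst n * √t / D ^ (n + 3) := by
  have hs := Real.sqrt_pos.2 ht
  have hv0 : 0 ≤ ‖z‖ ^ 2 / (4 * t) := by positivity
  have h0 := heatKernel_nonneg n ht.le z
  calc _ ≤ (n + 1) / t * (heatKernel n t z * (1 + ‖z‖ ^ 2 / (4 * t))) := abs_lapKernel_le_mul ht z
    _ ≤ (n + 1) / t * (heatKernel n t z * (1 + ‖z‖ ^ 2 / (4 * t)) ^ 2) := by
      gcongr
      nlinarith
    _ ≤ (n + 1) / t * (gaussConst n * √t ^ 3 / D ^ (n + 3)) := by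
      gcongr
      exact heatKernel_mul_sq_le ht z hD hDle
    _ = _ := by
      have : √t ^ 3 = t * √t := by rw [pow_succ, Real.sq_sqrt ht.le]
      rw [this]
      field_simp

/-- The derivative of `lapKernel` at `(τ, x)` in the direction `(d, w)`. -/
def lapKernelDeriv (n : ℕ) (τ : ℝ) (x : Euc n) (d : ℝ) (w : Euc n) : ℝ :=
  heatKernel n τ x / τ *
    ((-(n : ℝ) / 2 * (d / τ) - (2 * inner ℝ x w / (4 * τ) - ‖x‖ ^ 2 * d / (4 * τ ^ 2))) *
        (‖x‖ ^ 2 / (4 * τ) - n / 2) +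
      (2 * inner ℝ x w / (4 * τ) - ‖x‖ ^ 2 * d / (4 * τ ^ 2)) -
      (‖x‖ ^ 2 / (4 * τ) - n / 2) * (d / τ))

theorem abs_direction_le {n : ℕ} {σ r d : ℝ} {x w : Euc n} (hσ : 0 < σ) (hr : 0 < r)
    (hrσ : r ≤ σ) (hd : |d| ≤ r ^ 2) (hw : ‖w‖ ≤ r) :
    |d / σ ^ 2| ≤ r / σ ∧
    |2 * inner ℝ x w / (4 * σ ^ 2) - ‖x‖ ^ 2 * d / (4 * (σ ^ 2) ^ 2)| ≤
      2 * (r / σ) * (1 + ‖x‖ ^ 2 / (4 * σ ^ 2)) := by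
  have hdτ : |d / σ ^ 2| ≤ r / σ := by
    rw [abs_div, abs_of_pos (pow_pos hσ 2), div_le_div_iff₀ (by positivity) hσ]
    nlinarith [mul_le_mul_of_nonneg_right hd hσ.le, mul_pos hr hσ,
      mul_le_mul_of_nonneg_left hrσ (mul_pos hr hσ).le]
  refine ⟨hdτ, ?_⟩
  have hu : ‖x‖ ^ 2 / (4 * σ ^ 2) = (‖x‖ / (2 * σ)) ^ 2 := by
    rw [div_pow, mul_pow]; norm_num
  have hxu : ‖x‖ / (2 * σ) ≤ 1 + ‖x‖ ^ 2 / (4 * σ ^ 2) := by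
    rw [hu]
    nlinarith [sq_nonneg (‖x‖ / (2 * σ) - 1 / 2)]
  have e1 : |2 * inner ℝ x w / (4 * σ ^ 2)| ≤ r / σ * (1 + ‖x‖ ^ 2 / (4 * σ ^ 2)) := by
    rw [abs_div, abs_of_pos (by positivity : 0 < 4 * σ ^ 2), abs_mul, abs_two]
    have : |inner ℝ x w| ≤ ‖x‖ * r := (abs_real_inner_le_norm _ _).trans (by gcongr)
    calc _ ≤ 2 * (‖x‖ * r) / (4 * σ ^ 2) := by gcongr
      _ = r / σ * (‖x‖ / (2 * σ)) := by field_simp; ring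
      _ ≤ _ := by gcongr
  have e2 : |‖x‖ ^ 2 * d / (4 * (σ ^ 2) ^ 2)| ≤ r / σ * (1 + ‖x‖ ^ 2 / (4 * σ ^ 2)) := by
    have : ‖x‖ ^ 2 * d / (4 * (σ ^ 2) ^ 2) = d / σ ^ 2 * (‖x‖ ^ 2 / (4 * σ ^ 2)) := by
      field_simp
    rw [this, abs_mul, abs_of_nonneg (by positivity : 0 ≤ ‖x‖ ^ 2 / (4 * σ ^ 2))]
    gcongr
    linarith
  calc _ ≤ |2 * inner ℝ x w / (4 * σ ^ 2)| + |‖x‖ ^ 2 * d / (4 * (σ ^ 2) ^ 2)| := abs_sub _ _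
    _ ≤ _ := by linarith

theorem abs_bracket_le {n : ℕ} {δ V u e : ℝ} (he : 0 ≤ e) (hu : 0 ≤ u) (hδ : |δ| ≤ e)
    (hV : |V| ≤ 2 * e * (1 + u)) :
    |(-(n : ℝ) / 2 * δ - V) * (u - n / 2) + V - (u - n / 2) * δ| ≤
      2 * (n + 3) ^ 2 * e * (1 + u) ^ 2 := by
  have hn : (0 : ℝ) ≤ n := n.cast_nonneg
  have hun : |u - n / 2| ≤ (n + 1) * (1 + u) := by
    rw [abs_le]; constructor <;> nlinarith [mul_nonneg hn hu]
  have b1 : |(-(n : ℝ) / 2 * δ - V)| ≤ (n + 2) * e * (1 + u) := by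
    calc _ ≤ |-(n : ℝ) / 2 * δ| + |V| := abs_sub _ _
      _ ≤ n / 2 * e + 2 * e * (1 + u) := by
        gcongr
        rw [abs_mul, abs_div, abs_neg, abs_of_nonneg hn, abs_two]
        gcongr
      _ ≤ _ := by nlinarith [mul_nonneg hn he, mul_nonneg (mul_nonneg hn he) hu]
  have h1u : 1 ≤ 1 + u := by linarith
  calc _ ≤ |(-(n : ℝ) / 2 * δ - V) * (u - n / 2)| + |V| + |(u - n / 2) * δ| :=
        (abs_sub _ _).trans (add_le_add (abs_add_le _ _) le_rfl)
    _ ≤ ((n + 2) * e * (1 + u)) * ((n + 1) * (1 + u)) + 2 * e * (1 + u) +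
          ((n + 1) * (1 + u)) * e := by
        rw [abs_mul, abs_mul]
        gcongr
    _ ≤ ((n + 2) * e * (1 + u)) * ((n + 1) * (1 + u)) + 2 * e * (1 + u) * (1 + u) +
          ((n + 1) * (1 + u)) * e * (1 + u) := by
        exact add_le_add (add_le_add le_rfl (le_mul_of_one_le_right (by positivity) h1u))
          (le_mul_of_one_le_right (by positivity) h1u)
    _ = (((n : ℝ) + 2) * (n + 1) + 2 + (n + 1)) * (e * (1 + u) ^ 2) := by ring
    _ ≤ (2 * (n + 3) ^ 2) * (e * (1 + u) ^ 2) := by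
        gcongr
        nlinarith
    _ = _ := by ring

theorem abs_lapKernelDeriv_le {n : ℕ} {σ r d D : ℝ} {x w : Euc n} (hσ : 0 < σ) (hr : 0 < r)
    (hrσ : r ≤ σ) (hd : |d| ≤ r ^ 2) (hw : ‖w‖ ≤ r) (hD : 0 < D) (hDle : D ≤ max σ ‖x‖) :
    |lapKernelDeriv n (σ ^ 2) x d w| ≤
      (n + 3) ^ 2 * 2 * gaussConst n * r / D ^ (n + 3) := by
  have hτ : 0 < σ ^ 2 := by positivity
  have hsq : √(σ ^ 2) = σ := Real.sqrt_sq hσ.le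
  have hmain := heatKernel_mul_sq_le hτ x hD (by rwa [hsq])
  have hk0 := heatKernel_nonneg n hτ.le x
  obtain ⟨h1, h2⟩ := abs_direction_le (x := x) hσ hr hrσ hd hw
  have h3 := abs_bracket_le (n := n) (by positivity) (by positivity) h1 h2
  rw [hsq] at hmain
  unfold lapKernelDeriv
  rw [abs_mul, abs_of_nonneg (by positivity : 0 ≤ heatKernel n (σ ^ 2) x / σ ^ 2)]
  calc _ ≤ heatKernel n (σ ^ 2) x / σ ^ 2 *
        (2 * (n + 3) ^ 2 * (r / σ) * (1 + ‖x‖ ^ 2 / (4 * σ ^ 2)) ^ 2) := by gcongr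
    _ = (2 * (n + 3) ^ 2 * (r / σ) / σ ^ 2) *
        (heatKernel n (σ ^ 2) x * (1 + ‖x‖ ^ 2 / (4 * σ ^ 2)) ^ 2) := by ring
    _ ≤ (2 * (n + 3) ^ 2 * (r / σ) / σ ^ 2) * (gaussConst n * σ ^ 3 / D ^ (n + 3)) := by
        gcongr
    _ = _ := by
        field_simp

theorem hasDerivAt_lapKernel_line {n : ℕ} {t d θ : ℝ} {z w : Euc n} (hpos : 0 < t + θ * d) :
    HasDerivAt (fun θ : ℝ => lapKernel n (t + θ * d) (z + θ • w))
      (lapKernelDeriv n (t + θ * d) (z + θ • w) d w) θ := by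
  have hT : HasDerivAt (fun θ : ℝ => t + θ * d) d θ :=
    (((hasDerivAt_id θ).mul_const d).const_add t).congr_deriv (by simp)
  have hZ0 : HasDerivAt (fun θ : ℝ => z + θ • w) w θ :=
    (((hasDerivAt_id θ).smul_const w).const_add z).congr_deriv (by simp)
  have hZ : HasDerivAt (fun x : ℝ => ‖z + x • w‖ ^ 2) (2 * inner ℝ (z + θ • w) w) θ := hZ0.norm_sq
  have h1 := hasDerivAt_heatKernel_comp hT hpos hZ
  have h2 : HasDerivAt
      (fun θ : ℝ => ‖z + θ • w‖ ^ 2 / (4 * (t + θ * d) ^ 2) - n / (2 * (t + θ * d))) _ θ :=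
    (hZ.fun_div ((hT.fun_pow 2).const_mul 4) (by positivity)).fun_sub
      ((hasDerivAt_const θ (n : ℝ)).fun_div (hT.const_mul 2) (by positivity))
  refine (h1.mul h2).congr_deriv ?_
  unfold lapKernelDeriv
  generalize t + θ * d = τ at *
  generalize z + θ • w = x at *
  field_simp
  ring

theorem abs_lapKernel_sub_le {n : ℕ} {t d r : ℝ} {z w : Euc n} (hr : 0 < r) (ht : 4 * r ^ 2 ≤ t)
    (hd : |d| ≤ r ^ 2) (hw : ‖w‖ ≤ r) :
    |lapKernel n (t + d) (z + w) - lapKernel n t z| ≤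
      2 ^ (n + 3) * (n + 3) ^ 2 * 2 * gaussConst n * r / (max √t ‖z‖) ^ (n + 3) := by
  have ht0 : 0 < t := by nlinarith [sq_pos_of_pos hr]
  have hst := Real.sqrt_pos.2 ht0
  have hst2 : √t ^ 2 = t := Real.sq_sqrt ht0.le
  have hD : 0 < max √t ‖z‖ := lt_max_of_lt_left hst
  have hrt : 2 * r ≤ √t := by
    apply Real.le_sqrt_of_sq_le
    nlinarith
  have hT : ∀ θ ∈ Icc (0 : ℝ) 1, 3 / 4 * t ≤ t + θ * d := by
    intro θ hθ
    have : |θ * d| ≤ r ^ 2 := by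
      rw [abs_mul, abs_of_nonneg hθ.1]
      nlinarith [hθ.2, abs_nonneg d]
    have := (abs_le.1 this).1
    linarith
  have hbound : ∀ θ ∈ Icc (0 : ℝ) 1, ‖lapKernelDeriv n (t + θ * d) (z + θ • w) d w‖ ≤
      2 ^ (n + 3) * (n + 3) ^ 2 * 2 * gaussConst n * r / (max √t ‖z‖) ^ (n + 3) := by
    intro θ hθ
    have hTge := hT θ hθ
    have hTpos : 0 < t + θ * d := by linarith
    have hσt : √t / 2 ≤ √(t + θ * d) := by
      apply Real.le_sqrt_of_sq_le
      nlinarith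
    have hxz : ‖z‖ - r ≤ ‖z + θ • w‖ := by
      have h1 : ‖z‖ ≤ ‖z + θ • w‖ + ‖θ • w‖ := by
        simpa using norm_sub_le (z + θ • w) (θ • w)
      have h2 : ‖θ • w‖ ≤ r := by
        rw [norm_smul, Real.norm_eq_abs, abs_of_nonneg hθ.1]
        nlinarith [hθ.2, norm_nonneg w]
      linarith
    have hDle : max √t ‖z‖ / 2 ≤ max √(t + θ * d) ‖z + θ • w‖ := by
      rcases le_total √t ‖z‖ with h | h
      · rw [max_eq_right h]
        exact le_max_of_le_right (by linarith)
      · rw [max_eq_left h]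
        exact le_max_of_le_left hσt
    have := abs_lapKernelDeriv_le (Real.sqrt_pos.2 hTpos) hr (by linarith) hd hw (half_pos hD) hDle
    rw [Real.sq_sqrt hTpos.le] at this
    rw [Real.norm_eq_abs]
    refine this.trans (le_of_eq ?_)
    rw [div_pow]
    field_simp
  have := norm_image_sub_le_of_norm_deriv_le_segment_01'
    (f := fun θ : ℝ => lapKernel n (t + θ * d) (z + θ • w))
    (fun θ hθ => (hasDerivAt_lapKernel_line (by linarith [hT θ hθ])).hasDerivWithinAt)
    (fun θ hθ => hbound θ (Ico_subset_Icc_self hθ))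
  simpa using this

open FourierTransform SchwartzMap in
theorem integral_fourier_mul_eq_flip {E : Type*} [NormedAddCommGroup E] [InnerProductSpace ℝ E]
    [FiniteDimensional ℝ E] [MeasurableSpace E] [BorelSpace E] {f g : E → ℂ}
    (hf : Integrable f) (hg : Integrable g) :
    ∫ ξ, 𝓕 f ξ * g ξ = ∫ x, f x * 𝓕 g x := by
  simpa using! VectorFourier.integral_fourierIntegral_smul_eq_flip (L := innerₗ E)
    Real.continuous_fourierChar continuous_inner hf hg

open FourierTransform in
theorem continuous_fourier_of_integrable {E : Type*} [NormedAddCommGroup E]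
    [InnerProductSpace ℝ E] [FiniteDimensional ℝ E] [MeasurableSpace E] [BorelSpace E] {f : E → ℂ}
    (hf : Integrable f) : Continuous (𝓕 f) :=
  VectorFourier.fourierIntegral_continuous Real.continuous_fourierChar
    (by exact continuous_inner) hf

open FourierTransform in
/-- On `L¹ ∩ L²` the Fourier integral represents the `L²` Fourier transform. -/
theorem fourier_toLp_ae_eq {E : Type*} [NormedAddCommGroup E] [InnerProductSpace ℝ E]
    [FiniteDimensional ℝ E] [MeasurableSpace E] [BorelSpace E] {f : E → ℂ}
    (hf : Integrable f) (hf2 : MemLp f 2) :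
    (𝓕 (hf2.toLp f) : Lp ℂ 2 (volume : Measure E)) =ᵐ[volume] 𝓕 f := by
  apply ae_eq_of_integral_contDiff_smul_eq
  · exact (Lp.memLp _).locallyIntegrable one_le_two
  · exact (continuous_fourier_of_integrable hf).locallyIntegrable
  · intro g g_smooth g_cpt
    have hg₁ : HasCompactSupport (Complex.ofRealCLM ∘ g) := g_cpt.comp_left rfl
    have hg₂ : ContDiff ℝ (⊤ : ℕ∞) (Complex.ofRealCLM ∘ g) := by fun_prop
    set φ := hg₁.toSchwartzMap hg₂ with hφ
    have h1 := congrArg (fun T => T φ) (Lp.fourier_toTemperedDistribution_eq (hf2.toLp f))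
    simp only [TemperedDistribution.fourier_apply, Lp.toTemperedDistribution_apply] at h1
    have h2 := integral_fourier_mul_eq_flip φ.integrable hf
    calc ∫ x, g x • (𝓕 (hf2.toLp f) : Lp ℂ 2 (volume : Measure E)) x
        = ∫ x, φ x • (𝓕 (hf2.toLp f) : Lp ℂ 2 (volume : Measure E)) x := by
          simp [hφ]
      _ = ∫ x, (𝓕 φ) x • (hf2.toLp f) x := h1.symm
      _ = ∫ x, 𝓕 (φ : E → ℂ) x * f x := by
          apply integral_congr_ae
          filter_upwards [hf2.coeFn_toLp] with x hx
          rw [hx, SchwartzMap.fourier_coe, smul_eq_mul]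
      _ = ∫ x, φ x * 𝓕 f x := h2
      _ = _ := by simp [hφ]

open FourierTransform in
/-- Plancherel's theorem on `L¹ ∩ L²`. -/
theorem lintegral_fourier_sq {E : Type*} [NormedAddCommGroup E] [InnerProductSpace ℝ E]
    [FiniteDimensional ℝ E] [MeasurableSpace E] [BorelSpace E] {f : E → ℂ}
    (hf : Integrable f) (hf2 : MemLp f 2) :
    ∫⁻ ξ, ‖𝓕 f ξ‖ₑ ^ 2 = ∫⁻ x, ‖f x‖ₑ ^ 2 := by
  have h1 : eLpNorm (𝓕 f) 2 volume = eLpNorm f 2 volume := by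
    rw [← eLpNorm_congr_ae (fourier_toLp_ae_eq hf hf2), ← eLpNorm_congr_ae hf2.coeFn_toLp,
      ← Lp.enorm_def, ← Lp.enorm_def, ← ofReal_norm, ← ofReal_norm, Lp.norm_fourier_eq]
  have h2 := congrArg (fun x => x ^ (2 : ℝ)) h1
  simp only [eLpNorm_eq_lintegral_rpow_enorm_toReal two_ne_zero ENNReal.ofNat_ne_top,
    ENNReal.toReal_ofNat, ← ENNReal.rpow_mul] at h2
  simpa using h2

theorem measurable_heatKernel (n : ℕ) :
    Measurable (fun p : ℝ × Euc n => heatKernel n p.1 p.2) := by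
  unfold heatKernel; fun_prop

theorem measurable_lapKernel (n : ℕ) :
    Measurable (fun p : ℝ × Euc n => lapKernel n p.1 p.2) := by
  unfold lapKernel
  exact (measurable_heatKernel n).mul (by fun_prop)

theorem continuous_heatKernel (n : ℕ) (t : ℝ) : Continuous (heatKernel n t) := by
  unfold heatKernel; fun_prop

theorem continuous_lapKernel (n : ℕ) (t : ℝ) : Continuous (lapKernel n t) := by
  unfold lapKernel
  exact (continuous_heatKernel n t).mul (by fun_prop)

theorem integrable_gauss {n : ℕ} {b : ℝ} (hb : 0 < b) :
    Integrable (fun z : Euc n => Real.exp (-(‖z‖ ^ 2 / b))) := by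
  have := (GaussianFourier.integrable_cexp_neg_mul_sq_norm_add (V := Euc n) (b := ((b⁻¹ : ℝ) : ℂ))
    (by simpa using hb) 0 0).norm
  refine this.congr (ae_of_all _ fun z => ?_)
  simp only [Complex.norm_exp]
  congr 1
  simp [← Complex.ofReal_pow]
  ring

theorem integral_heatKernel {n : ℕ} {t : ℝ} (ht : 0 < t) : ∫ z, heatKernel n t z = 1 := by
  have hπ := Real.pi_pos
  have h := GaussianFourier.integral_rexp_neg_mul_sq_norm (V := Euc n)
    (b := (4 * t)⁻¹) (by positivity)
  have e : ∀ z : Euc n, heatKernel n t z =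
      (4 * Real.pi * t) ^ (-(n : ℝ) / 2) * Real.exp (-(4 * t)⁻¹ * ‖z‖ ^ 2) := by
    intro z
    unfold heatKernel
    congr 2
    field_simp
  simp_rw [e]
  rw [integral_const_mul, h, finrank_euclideanSpace_fin,
    show Real.pi / (4 * t)⁻¹ = 4 * Real.pi * t by field_simp,
    ← Real.rpow_add (by positivity), neg_div, neg_add_cancel, Real.rpow_zero]

theorem heatKernel_le_gauss {n : ℕ} {α τ β : ℝ} (hα : 0 < α) (h1 : α ≤ τ) (h2 : τ ≤ β)
    (z : Euc n) :
    heatKernel n τ z ≤ (√α ^ n)⁻¹ * Real.exp (-(‖z‖ ^ 2 / (8 * β))) := by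
  have hτ : 0 < τ := by linarith
  have hs := Real.sqrt_pos.2 hα
  refine (heatKernel_le hτ z).trans ?_
  gcongr ?_ * Real.exp (-(‖z‖ ^ 2 / ?_))
  · gcongr
  · linarith

theorem abs_lapKernel_le_gauss {n : ℕ} {α τ β : ℝ} (hα : 0 < α) (h1 : α ≤ τ) (h2 : τ ≤ β)
    (z : Euc n) :
    |lapKernel n τ z| ≤ 2 * (n + 1) / α * (√α ^ n)⁻¹ * Real.exp (-(‖z‖ ^ 2 / (8 * β))) := by
  have hτ : 0 < τ := by linarith
  have hs := Real.sqrt_pos.2 hα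
  have hk := heatKernel_nonneg n hτ.le z
  set v := ‖z‖ ^ 2 / (4 * τ) with hv
  have hv0 : 0 ≤ v := by positivity
  have e1 : heatKernel n τ z * (1 + v) ≤ (√α ^ n)⁻¹ * (2 * Real.exp (-(‖z‖ ^ 2 / (8 * β)))) := by
    have a1 : 1 + v ≤ 2 * Real.exp (v / 2) := by
      have := Real.add_one_le_exp (v / 2)
      linarith
    calc _ ≤ ((√τ ^ n)⁻¹ * Real.exp (-v)) * (2 * Real.exp (v / 2)) := by
          gcongr
          exact heatKernel_le hτ z
      _ = (√τ ^ n)⁻¹ * (2 * Real.exp (-(v / 2))) := by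
          rw [show -(v / 2) = -v + v / 2 by ring, Real.exp_add]
          ring
      _ ≤ _ := by
          gcongr ?_ * (2 * Real.exp (-?_))
          · gcongr
          · rw [hv, div_div]
            exact div_le_div_of_nonneg_left (by positivity) (by positivity) (by linarith)
  calc _ ≤ (n + 1) / τ * (heatKernel n τ z * (1 + v)) := abs_lapKernel_le_mul hτ z
    _ ≤ (n + 1) / α * ((√α ^ n)⁻¹ * (2 * Real.exp (-(‖z‖ ^ 2 / (8 * β))))) := by gcongr
    _ = _ := by ring

theorem integrable_heatKernel {n : ℕ} {t : ℝ} (ht : 0 < t) : Integrable (heatKernel n t) := by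
  refine ((integrable_gauss (b := 8 * t) (by positivity)).const_mul ((√t ^ n)⁻¹)).mono'
    (continuous_heatKernel n t).aestronglyMeasurable (ae_of_all _ fun z => ?_)
  rw [Real.norm_eq_abs, abs_of_nonneg (heatKernel_nonneg n ht.le z)]
  exact heatKernel_le_gauss ht le_rfl le_rfl z

open FourierTransform

theorem fourier_heatKernel {n : ℕ} {t : ℝ} (ht : 0 < t) (ξ : Euc n) :
    𝓕 (fun z => (heatKernel n t z : ℂ)) ξ =
      (Real.exp (-(4 * Real.pi ^ 2 * ‖ξ‖ ^ 2 * t)) : ℝ) := by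
  have hπ := Real.pi_pos
  have h := fourier_gaussian_innerProductSpace (V := Euc n) (b := (((4 * t)⁻¹ : ℝ) : ℂ))
    (by rw [Complex.ofReal_re]; positivity) ξ
  have e : (fun z : Euc n => (heatKernel n t z : ℂ)) =
      (((4 * Real.pi * t) ^ (-(n : ℝ) / 2) : ℝ) : ℂ) •
        (fun z : Euc n => Complex.exp (-(((4 * t)⁻¹ : ℝ) : ℂ) * (‖z‖ : ℂ) ^ 2)) := by
    ext z
    simp only [heatKernel, Pi.smul_apply, smul_eq_mul]
    push_cast
    congr 2
    field_simp
  have hsmul : ∀ (c : ℂ) (G : Euc n → ℂ), 𝓕 (c • G) ξ = c * 𝓕 G ξ := by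
    intro c G
    simp only [Real.fourier_eq, Pi.smul_apply, smul_eq_mul, Circle.smul_def]
    rw [← integral_const_mul]
    congr with v
    ring
  rw [e, hsmul, h, finrank_euclideanSpace_fin,
    show (Real.pi : ℂ) / (((4 * t)⁻¹ : ℝ) : ℂ) = ((4 * Real.pi * t : ℝ) : ℂ) by
      push_cast; field_simp,
    show ((n : ℂ) / 2) = (((n : ℝ) / 2 : ℝ) : ℂ) by push_cast; rfl,
    ← Complex.ofReal_cpow (by positivity), ← mul_assoc, ← Complex.ofReal_mul,
    ← Real.rpow_add (by positivity), neg_div, neg_add_cancel, Real.rpow_zero, Complex.ofReal_one,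
    one_mul, Complex.ofReal_exp]
  congr 1
  push_cast
  field_simp

theorem hasDerivAt_fourier_heatKernel {n : ℕ} {t : ℝ} (ht : 0 < t) (ξ : Euc n) :
    HasDerivAt (fun t => 𝓕 (fun z => (heatKernel n t z : ℂ)) ξ)
      (𝓕 (fun z => (lapKernel n t z : ℂ)) ξ) t := by
  simp only [Real.fourier_eq]
  have hint := (integrable_gauss (n := n) (b := 8 * (2 * t)) (by positivity)).const_mul
    (2 * (n + 1) / (t / 2) * (√(t / 2) ^ n)⁻¹)
  refine (hasDerivAt_integral_of_dominated_loc_of_deriv_le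
    (F := fun τ z => Real.fourierChar (-inner ℝ z ξ) • (heatKernel n τ z : ℂ))
    (F' := fun τ z => Real.fourierChar (-inner ℝ z ξ) • (lapKernel n τ z : ℂ))
    (s := Icc (t / 2) (2 * t)) (Icc_mem_nhds (by linarith) (by linarith))
    ?_ ?_ ?_ ?_ hint ?_).2
  · refine Eventually.of_forall fun τ => ?_
    have := continuous_heatKernel n τ
    exact Continuous.aestronglyMeasurable (by fun_prop)
  · exact (Real.fourierIntegral_convergent_iff ξ).2 (integrable_heatKernel ht).ofReal
  · have := continuous_lapKernel n t
    exact Continuous.aestronglyMeasurable (by fun_prop)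
  · refine ae_of_all _ fun z τ hτ => ?_
    rw [Circle.norm_smul, Complex.norm_real]
    exact abs_lapKernel_le_gauss (by linarith) hτ.1 hτ.2 z
  · refine ae_of_all _ fun z τ hτ => ?_
    have hτ0 : 0 < τ := by linarith [hτ.1]
    exact ((hasDerivAt_heatKernel hτ0 z).ofReal_comp).const_smul _

theorem fourier_lapKernel {n : ℕ} {t : ℝ} (ht : 0 < t) (ξ : Euc n) :
    𝓕 (fun z => (lapKernel n t z : ℂ)) ξ =
      (-(4 * Real.pi ^ 2 * ‖ξ‖ ^ 2 * Real.exp (-(4 * Real.pi ^ 2 * ‖ξ‖ ^ 2 * t))) : ℝ) := by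
  have h1 := hasDerivAt_fourier_heatKernel ht ξ
  have h2 : HasDerivAt (fun t : ℝ => ((Real.exp (-(4 * Real.pi ^ 2 * ‖ξ‖ ^ 2 * t)) : ℝ) : ℂ))
      ((-(4 * Real.pi ^ 2 * ‖ξ‖ ^ 2 * Real.exp (-(4 * Real.pi ^ 2 * ‖ξ‖ ^ 2 * t))) : ℝ) : ℂ) t := by
    refine HasDerivAt.ofReal_comp ?_
    refine (((hasDerivAt_id t).const_mul (4 * Real.pi ^ 2 * ‖ξ‖ ^ 2)).fun_neg.exp).congr_deriv ?_
    simp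
    ring
  refine h1.unique (h2.congr_of_eventuallyEq ?_)
  filter_upwards [lt_mem_nhds ht] with τ hτ
  exact fourier_heatKernel hτ ξ

theorem hasFDerivAt_heatKernel {n : ℕ} (t : ℝ) (y x : Euc n) :
    HasFDerivAt (fun x => heatKernel n t (x - y))
      ((heatKernel n t (x - y) * -(1 / (2 * t))) • innerSL ℝ (x - y)) x := by
  have h1 : HasFDerivAt (fun x : Euc n => x - y) (ContinuousLinearMap.id ℝ (Euc n)) x :=
    (hasFDerivAt_id x).sub_const y
  have h2 := ((h1.norm_sq.fun_neg.mul_const (4 * t)⁻¹).exp).const_mul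
    ((4 * Real.pi * t) ^ (-(n : ℝ) / 2))
  refine (h2.congr_fderiv ?_).congr_of_eventuallyEq (Eventually.of_forall fun z => ?_)
  · ext v
    simp [heatKernel, div_eq_mul_inv]
    ring
  · simp [heatKernel, div_eq_mul_inv]

theorem contDiff_heatKernel (n : ℕ) (t : ℝ) (y : Euc n) :
    ContDiff ℝ 2 (fun x => heatKernel n t (x - y)) := by
  unfold heatKernel
  have : ContDiff ℝ 2 (fun x : Euc n => ‖x - y‖ ^ 2) := (contDiff_id.sub contDiff_const).norm_sq ℝ
  fun_prop

/-- The second derivative of the heat kernel along a fixed vector. -/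
theorem fderiv_fderiv_heatKernel {n : ℕ} (t : ℝ) (y e x : Euc n) :
    fderiv ℝ (fun x => fderiv ℝ (fun x => heatKernel n t (x - y)) x e) x e =
      heatKernel n t (x - y) *
        ((1 / (2 * t)) ^ 2 * (inner ℝ (x - y) e) ^ 2 - 1 / (2 * t) * ‖e‖ ^ 2) := by
  have h0 : (fun x => fderiv ℝ (fun x => heatKernel n t (x - y)) x e) =
      fun x => heatKernel n t (x - y) * (-(1 / (2 * t)) * inner ℝ (x - y) e) := by
    ext x
    rw [(hasFDerivAt_heatKernel t y x).fderiv]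
    simp [mul_assoc, inner_sub_left]
  have h1 : HasFDerivAt (fun x : Euc n => x - y) (ContinuousLinearMap.id ℝ (Euc n)) x :=
    (hasFDerivAt_id x).sub_const y
  have h2 := (hasFDerivAt_heatKernel t y x).fun_mul
    ((h1.inner ℝ (hasFDerivAt_const e x)).const_mul (-(1 / (2 * t))))
  rw [h0, h2.fderiv]
  simp [fderivInnerCLM_apply, inner_sub_left]
  ring

theorem sum_fderiv_fderiv_heatKernel {n : ℕ} (t : ℝ) (y x : Euc n) :
    ∑ i : Fin n, fderiv ℝ (fun x => fderiv ℝ (fun x => heatKernel n t (x - y)) x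
      (EuclideanSpace.single i 1)) x (EuclideanSpace.single i 1) = lapKernel n t (x - y) := by
  simp_rw [fderiv_fderiv_heatKernel, ← Finset.mul_sum, Finset.sum_sub_distrib, ← Finset.mul_sum]
  unfold lapKernel
  rw [EuclideanSpace.norm_sq_eq]
  simp [EuclideanSpace.inner_single_right]
  left
  ring

theorem lapl_eq_sum {n : ℕ} {φ : Euc n → ℝ} (hφ : ContDiff ℝ 2 φ) (x : Euc n) :
    lapl φ x = ∑ i : Fin n, fderiv ℝ (fun x => fderiv ℝ φ x (EuclideanSpace.single i 1)) x
      (EuclideanSpace.single i 1) := by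
  unfold lapl
  refine Finset.sum_congr rfl fun i _ => ?_
  rw [iteratedFDeriv_two_apply]
  have : DifferentiableAt ℝ (fderiv ℝ φ) x :=
    ((hφ.fderiv_right (m := 1) le_rfl).differentiable one_ne_zero) x
  rw [fderiv_clm_apply this (differentiableAt_const _)]
  simp

theorem continuous_lapl {n : ℕ} {φ : Euc n → ℝ} (hφ : ContDiff ℝ 2 φ) : Continuous (lapl φ) := by
  unfold lapl
  refine continuous_finsetSum _ fun i _ => ?_
  have := hφ.continuous_iteratedFDeriv' (m := 2)
  fun_prop

theorem hasCompactSupport_lapl {n : ℕ} {φ : Euc n → ℝ} (hc : HasCompactSupport φ) :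
    HasCompactSupport (lapl φ) := by
  refine (hc.iteratedFDeriv (𝕜 := ℝ) 2).mono fun x hx => ?_
  contrapose! hx
  simp only [Function.mem_support, not_not] at hx ⊢
  simp [lapl, hx]

theorem integral_mul_fderiv_fderiv {n : ℕ} {h φ : Euc n → ℝ} (hh : ContDiff ℝ 2 h)
    (hφ : ContDiff ℝ 2 φ) (hc : HasCompactSupport φ) (e : Euc n) :
    ∫ x, h x * fderiv ℝ (fun x => fderiv ℝ φ x e) x e =
      ∫ x, fderiv ℝ (fun x => fderiv ℝ h x e) x e * φ x := by
  have d1 : ∀ {f : Euc n → ℝ}, ContDiff ℝ 2 f → ContDiff ℝ 1 (fun x => fderiv ℝ f x e) :=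
    fun hf => (hf.fderiv_right (m := 1) le_rfl).clm_apply contDiff_const
  have d2 : ∀ {f : Euc n → ℝ}, ContDiff ℝ 1 f → Continuous (fun x => fderiv ℝ f x e) :=
    fun hf => ((hf.fderiv_right (m := 0) le_rfl).clm_apply contDiff_const).continuous
  have c1 : ∀ {f : Euc n → ℝ}, HasCompactSupport f →
      HasCompactSupport (fun x => fderiv ℝ f x e) := fun hf => hf.fderiv_apply (𝕜 := ℝ) e
  have k : ∀ {f g : Euc n → ℝ}, Continuous f → Continuous g → HasCompactSupport g →
      Integrable (fun x => f x * g x) := fun hf hg hgc =>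
    (hf.mul hg).integrable_of_hasCompactSupport hgc.mul_left
  have hh1 := d1 hh
  have hφ1 := d1 hφ
  have hc1 := c1 hc
  have a1 := integral_mul_fderiv_eq_neg_fderiv_mul_of_integrable (μ := volume)
    (f := h) (g := fun x => fderiv ℝ φ x e) (v := e)
    (k hh1.continuous hφ1.continuous hc1) (k hh.continuous (d2 hφ1) (c1 hc1))
    (k hh.continuous hφ1.continuous hc1) (fun _ _ => hh.differentiable two_ne_zero _)
    (fun _ _ => hφ1.differentiable one_ne_zero _)
  have a2 := integral_mul_fderiv_eq_neg_fderiv_mul_of_integrable (μ := volume)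
    (f := fun x => fderiv ℝ h x e) (g := φ) (v := e)
    (k (d2 hh1) hφ.continuous hc) (k hh1.continuous hφ1.continuous hc1)
    (k hh1.continuous hφ.continuous hc) (fun _ _ => hh1.differentiable one_ne_zero _)
    (fun _ _ => hφ.differentiable two_ne_zero _)
  rw [a1, a2, neg_neg]

theorem integral_lapKernel_mul {n : ℕ} (t : ℝ) (y : Euc n) {φ : Euc n → ℝ}
    (hφ : ContDiff ℝ 2 φ) (hc : HasCompactSupport φ) :
    ∫ x, lapKernel n t (x - y) * φ x = ∫ x, heatKernel n t (x - y) * lapl φ x := by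
  have hh := contDiff_heatKernel n t y
  have d2 : ∀ {f : Euc n → ℝ}, ContDiff ℝ 2 f → ∀ e : Euc n,
      Continuous (fun x => fderiv ℝ (fun x => fderiv ℝ f x e) x e) := by
    intro f hf e
    have h1 : ContDiff ℝ 1 (fun x => fderiv ℝ f x e) :=
      (hf.fderiv_right (m := 1) le_rfl).clm_apply contDiff_const
    exact ((h1.fderiv_right (m := 0) le_rfl).clm_apply contDiff_const).continuous
  simp_rw [← sum_fderiv_fderiv_heatKernel, lapl_eq_sum hφ, Finset.sum_mul, Finset.mul_sum]
  rw [integral_finsetSum, integral_finsetSum]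
  · exact Finset.sum_congr rfl fun i _ => (integral_mul_fderiv_fderiv hh hφ hc _).symm
  · exact fun i _ => (hh.continuous.mul (d2 hφ _)).integrable_of_hasCompactSupport
      ((hc.fderiv_apply (𝕜 := ℝ) _).fderiv_apply (𝕜 := ℝ) _).mul_left
  · exact fun i _ => ((d2 hh _).mul hφ.continuous).integrable_of_hasCompactSupport hc.mul_left

theorem sq_lintegral_mul_le {α : Type*} [MeasurableSpace α] {μ : Measure α} {m g : α → ENNReal}
    (hm : Measurable m) (hg : Measurable g) :
    (∫⁻ x, m x * g x ∂μ) ^ 2 ≤ (∫⁻ x, m x ∂μ) * ∫⁻ x, m x * g x ^ 2 ∂μ := by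
  have h := ENNReal.lintegral_mul_le_Lp_mul_Lq (μ.withDensity m) Real.HolderConjugate.two_two
    (f := fun _ => 1) (g := g) aemeasurable_const hg.aemeasurable
  have h2 := ENNReal.rpow_le_rpow h (z := 2) zero_le_two
  simp only [Pi.mul_apply, one_mul, ENNReal.one_rpow, lintegral_const, one_mul] at h2
  rw [ENNReal.mul_rpow_of_nonneg _ _ zero_le_two, ← ENNReal.rpow_mul, ← ENNReal.rpow_mul,
    lintegral_withDensity_eq_lintegral_mul _ hm hg,
    lintegral_withDensity_eq_lintegral_mul _ hm (by fun_prop),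
    withDensity_apply _ MeasurableSet.univ] at h2
  simpa using h2

/-- Young's inequality `‖m * g‖₂ ≤ ‖m‖₁ ‖g‖₂` on the line. -/
theorem lintegral_sq_conv_le {m g : ℝ → ENNReal} (hm : Measurable m) (hg : Measurable g) :
    ∫⁻ t, (∫⁻ s, m (t - s) * g s) ^ 2 ≤ (∫⁻ τ, m τ) ^ 2 * ∫⁻ s, g s ^ 2 := by
  have hmeas : Measurable (Function.uncurry fun t s : ℝ => m (t - s) * g s ^ 2) := by
    unfold Function.uncurry
    fun_prop
  calc _ ≤ ∫⁻ t, (∫⁻ s, m (t - s)) * ∫⁻ s, m (t - s) * g s ^ 2 :=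
        lintegral_mono fun t => sq_lintegral_mul_le (by fun_prop) hg
    _ = ∫⁻ t, (∫⁻ τ, m τ) * ∫⁻ s, m (t - s) * g s ^ 2 := by
        congr 1 with t
        rw [lintegral_sub_left_eq_self m t]
    _ = (∫⁻ τ, m τ) * ∫⁻ t, ∫⁻ s, m (t - s) * g s ^ 2 :=
        lintegral_const_mul _ hmeas.lintegral_prod_right
    _ = (∫⁻ τ, m τ) * ∫⁻ s, ∫⁻ t, m (t - s) * g s ^ 2 := by
        rw [lintegral_lintegral_swap hmeas.aemeasurable]
    _ = (∫⁻ τ, m τ) * ∫⁻ s, (∫⁻ τ, m τ) * g s ^ 2 := by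
        congr 2 with s
        rw [lintegral_mul_const _ (by fun_prop), lintegral_sub_right_eq_self m s]
    _ = _ := by
        rw [lintegral_const_mul _ (by fun_prop), ← mul_assoc, sq]

theorem lintegral_mul_exp_le_one {w : ℝ} (hw : 0 ≤ w) :
    ∫⁻ τ in Ioi (0 : ℝ), ENNReal.ofReal (w * Real.exp (-(w * τ))) ≤ 1 := by
  rcases hw.eq_or_lt with rfl | hw
  · simp
  · have h := integral_exp_mul_Ioi (a := -w) (by linarith) 0
    have hi := integrableOn_exp_mul_Ioi (a := -w) (by linarith) 0
    simp only [neg_mul] at h hi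
    rw [← ofReal_integral_eq_lintegral_ofReal (hi.const_mul w)
      (ae_of_all _ fun τ => by positivity), integral_const_mul, h]
    simp [hw.ne']

theorem lintegral_mul_exp_le_mul {w ε : ℝ} (hw : 0 ≤ w) :
    ∫⁻ τ in Ioc (0 : ℝ) ε, ENNReal.ofReal (w * Real.exp (-(w * τ))) ≤ ENNReal.ofReal (w * ε) := by
  calc _ ≤ ∫⁻ τ in Ioc (0 : ℝ) ε, ENNReal.ofReal w := by
        refine setLIntegral_mono measurable_const fun τ hτ => ENNReal.ofReal_le_ofReal ?_
        have : 0 ≤ w * τ := mul_nonneg hw hτ.1.le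
        exact mul_le_of_le_one_right hw (Real.exp_le_one_iff.2 (by linarith))
    _ = _ := by
        rw [setLIntegral_const, Real.volume_Ioc, sub_zero, ENNReal.ofReal_mul hw]

/-- Bounded measurable integrable functions on `ℝ × ℝⁿ` vanishing for nonpositive times. -/
structure IsSource {n : ℕ} (a : ℝ × Euc n → ℝ) : Prop where
  meas : Measurable a
  int : Integrable a
  bdd : ∃ M, ∀ q, |a q| ≤ M
  zero : ∀ q, q.1 ≤ 0 → a q = 0

/-- The kernel of the maximal regularity operator restricted to the time lags in `I`. -/
def mrKernel (n : ℕ) (I : Set ℝ) (τ : ℝ) (z : Euc n) : ℝ :=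
  I.indicator (fun τ => lapKernel n τ z) τ

/-- The maximal regularity operator restricted to the time lags in `I`. -/
def maxReg {n : ℕ} (I : Set ℝ) (a : ℝ × Euc n → ℝ) (p : ℝ × Euc n) : ℝ :=
  ∫ q, mrKernel n I (p.1 - q.1) (p.2 - q.2) * a q

theorem measurable_mrKernel {n : ℕ} {I : Set ℝ} (hI : MeasurableSet I) :
    Measurable (fun p : ℝ × Euc n => mrKernel n I p.1 p.2) := by
  have : (fun p : ℝ × Euc n => mrKernel n I p.1 p.2) =
      (Prod.fst ⁻¹' I).indicator (fun p => lapKernel n p.1 p.2) := by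
    ext p
    by_cases h : p.1 ∈ I <;> simp [mrKernel, h]
  rw [this]
  exact (measurable_lapKernel n).indicator (measurable_fst hI)

namespace IsSource

variable {n : ℕ} {a : ℝ × Euc n → ℝ} {I : Set ℝ} {ε : ℝ}

theorem norm_mrKernel_mul_le (ha : IsSource a) (hε : 0 < ε) (hIε : I ⊆ Ioi ε) (t : ℝ) (x : Euc n)
    (q : ℝ × Euc n) :
    ‖mrKernel n I (t - q.1) (x - q.2) * a q‖ ≤
      2 * (n + 1) / ε * (√ε ^ n)⁻¹ *
        (Real.exp (-(‖x - q.2‖ ^ 2 / (8 * max t ε))) * |a q|) := by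
  by_cases hq : q.1 ≤ 0
  · simp [ha.zero q hq]
  by_cases hI : t - q.1 ∈ I
  · rw [norm_mul, ← mul_assoc]
    simp only [mrKernel, hI, indicator_of_mem, Real.norm_eq_abs]
    gcongr
    exact abs_lapKernel_le_gauss hε (le_of_lt (hIε hI))
      (le_max_of_le_left (by linarith [not_le.1 hq])) _
  · simp only [mrKernel, hI, not_false_eq_true, indicator_of_notMem, zero_mul, norm_zero]
    positivity

theorem abs_mrKernel_mul_le (ha : IsSource a) (hε : 0 < ε) (hIε : I ⊆ Ioi ε) (t : ℝ) (x : Euc n)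
    (q : ℝ × Euc n) :
    ‖mrKernel n I (t - q.1) (x - q.2) * a q‖ ≤ 2 * (n + 1) / ε * (√ε ^ n)⁻¹ * |a q| := by
  refine (ha.norm_mrKernel_mul_le hε hIε t x q).trans ?_
  gcongr
  refine mul_le_of_le_one_left (abs_nonneg _) (Real.exp_le_one_iff.2 ?_)
  have : 0 < max t ε := lt_max_of_lt_right hε
  have : 0 ≤ ‖x - q.2‖ ^ 2 / (8 * max t ε) := by positivity
  linarith

theorem measurable_integrand (ha : IsSource a) (hI : MeasurableSet I) :
    Measurable (fun z : (ℝ × Euc n) × (ℝ × Euc n) =>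
      mrKernel n I (z.1.1 - z.2.1) (z.1.2 - z.2.2) * a z.2) :=
  ((measurable_mrKernel (n := n) hI).comp
    (g := fun p : ℝ × Euc n => mrKernel n I p.1 p.2)
    (f := fun z : (ℝ × Euc n) × (ℝ × Euc n) => (z.1.1 - z.2.1, z.1.2 - z.2.2))
    (by fun_prop)).mul (ha.meas.comp measurable_snd)

theorem integrable_integrand (ha : IsSource a) (hI : MeasurableSet I) (hε : 0 < ε)
    (hIε : I ⊆ Ioi ε) (p : ℝ × Euc n) :
    Integrable (fun q => mrKernel n I (p.1 - q.1) (p.2 - q.2) * a q) := by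
  refine (ha.int.abs.const_mul (2 * (n + 1) / ε * (√ε ^ n)⁻¹)).mono'
    ((ha.measurable_integrand hI).comp (measurable_const.prodMk measurable_id)
      |>.aestronglyMeasurable (f := fun q => mrKernel n I (p.1 - q.1) (p.2 - q.2) * a q))
    (ae_of_all _ fun q => ha.abs_mrKernel_mul_le hε hIε _ _ _)

theorem measurable_maxReg (ha : IsSource a) (hI : MeasurableSet I) : Measurable (maxReg I a) :=
  (ha.measurable_integrand hI).stronglyMeasurable.integral_prod_right.measurable

theorem integrable_prod (ha : IsSource a) (hI : MeasurableSet I) (hε : 0 < ε)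
    (hIε : I ⊆ Ioi ε) (t : ℝ) :
    Integrable (fun z : Euc n × (ℝ × Euc n) => mrKernel n I (t - z.2.1) (z.1 - z.2.2) * a z.2)
      (volume.prod volume) := by
  have hβ : 0 < max t ε := lt_max_of_lt_right hε
  have hg := integrable_gauss (n := n) (b := 8 * max t ε) (by positivity)
  have key : Integrable (fun z : Euc n × (ℝ × Euc n) =>
      Real.exp (-(‖z.1 - z.2.2‖ ^ 2 / (8 * max t ε))) * |a z.2|) (volume.prod volume) := by
    have hm := ha.meas
    have hmeas : Measurable (fun z : Euc n × (ℝ × Euc n) =>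
      Real.exp (-(‖z.1 - z.2.2‖ ^ 2 / (8 * max t ε))) * |a z.2|) := by fun_prop
    refine (integrable_prod_iff' hmeas.aestronglyMeasurable).2 ⟨ae_of_all _ fun q => ?_, ?_⟩
    · have := (hg.comp_sub_right q.2).mul_const |a q|
      exact this
    · have : ∀ q : ℝ × Euc n, ∫ x : Euc n, ‖Real.exp (-(‖x - q.2‖ ^ 2 / (8 * max t ε))) * |a q|‖ =
          (∫ z : Euc n, Real.exp (-(‖z‖ ^ 2 / (8 * max t ε)))) * |a q| := by
        intro q
        simp only [norm_mul, Real.norm_eq_abs, Real.abs_exp, abs_abs]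
        rw [integral_mul_const,
          integral_sub_right_eq_self (fun z : Euc n => Real.exp (-(‖z‖ ^ 2 / (8 * max t ε))))]
      simp only [this]
      exact ha.int.abs.const_mul _
  refine (key.const_mul (2 * (n + 1) / ε * (√ε ^ n)⁻¹)).mono'
    ((ha.measurable_integrand hI).comp
      (f := fun z : Euc n × (ℝ × Euc n) => ((t, z.1), z.2)) (by fun_prop)).aestronglyMeasurable
    (ae_of_all _ fun z => ha.norm_mrKernel_mul_le hε hIε _ _ _)

theorem integrable_slice (ha : IsSource a) (hI : MeasurableSet I) (hε : 0 < ε)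
    (hIε : I ⊆ Ioi ε) (t : ℝ) : Integrable (fun x => maxReg I a (t, x)) :=
  (ha.integrable_prod hI hε hIε t).integral_prod_left

theorem abs_maxReg_le (ha : IsSource a) (hε : 0 < ε) (hIε : I ⊆ Ioi ε)
    (p : ℝ × Euc n) :
    |maxReg I a p| ≤ 2 * (n + 1) / ε * (√ε ^ n)⁻¹ * ∫ q, |a q| := by
  rw [← integral_const_mul]
  exact norm_integral_le_of_norm_le (ha.int.abs.const_mul _)
    (ae_of_all _ fun q => ha.abs_mrKernel_mul_le hε hIε _ _ _)

end IsSource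

theorem memLp_two_of_integrable_of_bounded {α : Type*} [MeasurableSpace α] {μ : Measure α}
    {f : α → ℝ} (hf : Integrable f μ) {B : ℝ} (hB : ∀ x, |f x| ≤ B) : MemLp f 2 μ := by
  rw [memLp_two_iff_integrable_sq hf.1]
  simp_rw [sq]
  exact hf.bdd_mul hf.1 (ae_of_all _ hB)

namespace IsSource

variable {n : ℕ} {a : ℝ × Euc n → ℝ} {I : Set ℝ} {ε : ℝ}

theorem memLp_slice (ha : IsSource a) (hI : MeasurableSet I) (hε : 0 < ε)
    (hIε : I ⊆ Ioi ε) (t : ℝ) : MemLp (fun x => maxReg I a (t, x)) 2 :=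
  memLp_two_of_integrable_of_bounded (ha.integrable_slice hI hε hIε t)
    fun x => ha.abs_maxReg_le hε hIε (t, x)

/-- The Fourier transform in the space variable of the maximal regularity operator. -/
theorem fourier_maxReg (ha : IsSource a) (hI : MeasurableSet I) (hε : 0 < ε)
    (hIε : I ⊆ Ioi ε) (t : ℝ) (ξ : Euc n) :
    𝓕 (fun x => (maxReg I a (t, x) : ℂ)) ξ =
      ∫ q : ℝ × Euc n, ((I.indicator (fun τ => -(4 * Real.pi ^ 2 * ‖ξ‖ ^ 2 *
        Real.exp (-(4 * Real.pi ^ 2 * ‖ξ‖ ^ 2 * τ)))) (t - q.1) : ℝ) : ℂ) *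
        (Real.fourierChar (-inner ℝ q.2 ξ) • (a q : ℂ)) := by
  rw [Real.fourier_eq]
  have h1 : ∀ x, Real.fourierChar (-inner ℝ x ξ) • (maxReg I a (t, x) : ℂ) =
      ∫ q : ℝ × Euc n, Real.fourierChar (-inner ℝ x ξ) •
        ((mrKernel n I (t - q.1) (x - q.2) * a q : ℝ) : ℂ) := by
    intro x
    simp only [maxReg, ← integral_complex_ofReal, Circle.smul_def, smul_eq_mul]
    rw [integral_const_mul]
  simp_rw [h1]
  rw [integral_integral_swap]
  · congr 1 with q
    have h2 : ∀ x : Euc n, Real.fourierChar (-inner ℝ x ξ) •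
        ((mrKernel n I (t - q.1) (x - q.2) * a q : ℝ) : ℂ) =
        (Real.fourierChar (-inner ℝ (x - q.2) ξ) • (mrKernel n I (t - q.1) (x - q.2) : ℂ)) *
          (Real.fourierChar (-inner ℝ q.2 ξ) • (a q : ℂ)) := by
      intro x
      have : -inner ℝ x ξ = -inner ℝ (x - q.2) ξ + -inner ℝ q.2 ξ := by
        rw [inner_sub_left]; ring
      rw [this, AddChar.map_add_eq_mul]
      simp only [Circle.smul_def, smul_eq_mul, Circle.coe_mul]
      push_cast
      ring
    simp_rw [h2]
    rw [integral_mul_const, integral_sub_right_eq_self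
      (fun x : Euc n => Real.fourierChar (-inner ℝ x ξ) • (mrKernel n I (t - q.1) x : ℂ)),
      ← Real.fourier_eq]
    congr 1
    by_cases hq : t - q.1 ∈ I
    · simp only [mrKernel, hq, indicator_of_mem]
      exact fourier_lapKernel (hε.trans (hIε hq)) ξ
    · simp [mrKernel, hq, Real.fourier_eq]
  · have := (ha.integrable_prod hI hε hIε t).ofReal (𝕜 := ℂ)
    have hc : Continuous fun z : Euc n × (ℝ × Euc n) =>
        (Real.fourierChar (-inner ℝ z.1 ξ) : ℂ) :=
      (continuous_subtype_val.comp Real.continuous_fourierChar).comp (by fun_prop)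
    refine this.mono (hc.aestronglyMeasurable.mul this.1) (ae_of_all _ fun z => ?_)
    simp [Function.uncurry]

end IsSource

theorem lintegral_fourier_ofReal_sq {n : ℕ} {g : Euc n → ℝ} (hg : Integrable g)
    (hg2 : MemLp g 2) : ∫⁻ ξ, ‖𝓕 (fun x => (g x : ℂ)) ξ‖ₑ ^ 2 = ∫⁻ x, ‖g x‖ₑ ^ 2 := by
  have h1 : Integrable fun x => (g x : ℂ) := hg.ofReal
  have h2 : MemLp (fun x => (g x : ℂ)) 2 := hg2.ofReal
  rw [lintegral_fourier_sq h1 h2]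
  congr 1 with x
  rw [← ofReal_norm, ← ofReal_norm, Complex.norm_real]

/-- The Fourier transform of `a` in the space variable. -/
def fourierSlice {n : ℕ} (a : ℝ × Euc n → ℝ) (s : ℝ) (ξ : Euc n) : ℂ :=
  𝓕 (fun y => (a (s, y) : ℂ)) ξ

/-- The Fourier symbol of `-Δ`. -/
def lapSymbol {n : ℕ} (ξ : Euc n) : ℝ := 4 * Real.pi ^ 2 * ‖ξ‖ ^ 2

theorem lapSymbol_nonneg {n : ℕ} (ξ : Euc n) : 0 ≤ lapSymbol ξ := by
  unfold lapSymbol; positivity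

theorem continuous_lapSymbol {n : ℕ} : Continuous (lapSymbol (n := n)) := by
  unfold lapSymbol; fun_prop

/-- The Fourier multiplier at `ξ` of the lag `τ`, cut off to `τ ∈ I`. -/
def lagDensity {n : ℕ} (I : Set ℝ) (ξ : Euc n) (τ : ℝ) : ENNReal :=
  I.indicator (fun τ => ENNReal.ofReal (lapSymbol ξ * Real.exp (-(lapSymbol ξ * τ)))) τ

theorem measurable_lagDensity {n : ℕ} {I : Set ℝ} (hI : MeasurableSet I) :
    Measurable (fun p : Euc n × ℝ => lagDensity I p.1 p.2) := by
  have : (fun p : Euc n × ℝ => lagDensity I p.1 p.2) = (Prod.snd ⁻¹' I).indicator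
      (fun p => ENNReal.ofReal (lapSymbol p.1 * Real.exp (-(lapSymbol p.1 * p.2)))) := by
    ext p
    by_cases h : p.2 ∈ I <;> simp [lagDensity, h]
  rw [this]
  have hc := continuous_lapSymbol (n := n)
  exact (by fun_prop : Measurable fun p : Euc n × ℝ =>
    ENNReal.ofReal (lapSymbol p.1 * Real.exp (-(lapSymbol p.1 * p.2)))).indicator
    (measurable_snd hI)

theorem lintegral_lagDensity {n : ℕ} {I : Set ℝ} (hI : MeasurableSet I) (ξ : Euc n) :
    ∫⁻ τ, lagDensity I ξ τ =
      ∫⁻ τ in I, ENNReal.ofReal (lapSymbol ξ * Real.exp (-(lapSymbol ξ * τ))) :=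
  lintegral_indicator hI _

theorem lintegral_lagDensity_le_one {n : ℕ} {I : Set ℝ} (hI : MeasurableSet I) (h0 : I ⊆ Ioi 0)
    (ξ : Euc n) : ∫⁻ τ, lagDensity I ξ τ ≤ 1 := by
  rw [lintegral_lagDensity hI]
  exact (lintegral_mono_set h0).trans (lintegral_mul_exp_le_one (lapSymbol_nonneg ξ))

theorem lintegral_lagDensity_le_mul {n : ℕ} {I : Set ℝ} (hI : MeasurableSet I) {ε : ℝ}
    (h0 : I ⊆ Ioc 0 ε) (ξ : Euc n) :
    ∫⁻ τ, lagDensity I ξ τ ≤ ENNReal.ofReal (lapSymbol ξ * ε) := by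
  rw [lintegral_lagDensity hI]
  exact (lintegral_mono_set h0).trans (lintegral_mul_exp_le_mul (lapSymbol_nonneg ξ))

/-- The total squared mass of `a` at frequency `ξ`. -/
def specMass {n : ℕ} (a : ℝ × Euc n → ℝ) (ξ : Euc n) : ENNReal :=
  ∫⁻ s, ‖fourierSlice a s ξ‖ₑ ^ 2

namespace IsSource

variable {n : ℕ} {a : ℝ × Euc n → ℝ} {I : Set ℝ} {ε : ℝ}

theorem measurable_fourierSlice (ha : IsSource a) :
    Measurable (fun p : ℝ × Euc n => fourierSlice a p.1 p.2) := by
  simp only [fourierSlice, Real.fourier_eq]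
  have hc : Continuous fun z : (ℝ × Euc n) × Euc n =>
      (Real.fourierChar (-inner ℝ z.2 z.1.2) : ℂ) :=
    (continuous_subtype_val.comp Real.continuous_fourierChar).comp (by fun_prop)
  have hm : Measurable fun z : (ℝ × Euc n) × Euc n => (a (z.1.1, z.2) : ℂ) :=
    Complex.measurable_ofReal.comp (ha.meas.comp (by fun_prop))
  exact (hc.measurable.mul hm).stronglyMeasurable.integral_prod_right.measurable

theorem measurable_specMass (ha : IsSource a) : Measurable (specMass a) :=
  ((ha.measurable_fourierSlice.comp measurable_swap).enorm.pow_const 2).lintegral_prod_right'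

theorem enorm_fourier_maxReg_le (ha : IsSource a) (hI : MeasurableSet I) (hε : 0 < ε)
    (hIε : I ⊆ Ioi ε) (t : ℝ) (ξ : Euc n) :
    ‖𝓕 (fun x => (maxReg I a (t, x) : ℂ)) ξ‖ₑ ≤
      ∫⁻ s, lagDensity I ξ (t - s) * ‖fourierSlice a s ξ‖ₑ := by
  rw [ha.fourier_maxReg hI hε hIε]
  set k : ℝ → ℝ := I.indicator (fun τ => -(4 * Real.pi ^ 2 * ‖ξ‖ ^ 2 *
        Real.exp (-(4 * Real.pi ^ 2 * ‖ξ‖ ^ 2 * τ)))) with hk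
  have hkm : Measurable k := Measurable.indicator (by fun_prop) hI
  have hkb : ∀ τ, |k τ| ≤ lapSymbol ξ := by
    intro τ
    by_cases h : τ ∈ I
    · have h1 : 0 ≤ lapSymbol ξ * τ :=
        mul_nonneg (lapSymbol_nonneg ξ) (hε.trans (hIε h)).le
      have h2 : |k τ| = lapSymbol ξ * Real.exp (-(lapSymbol ξ * τ)) := by
        simp only [hk, h, indicator_of_mem, abs_neg]
        exact abs_of_nonneg (mul_nonneg (lapSymbol_nonneg ξ) (Real.exp_nonneg _))
      rw [h2]
      exact mul_le_of_le_one_right (lapSymbol_nonneg ξ) (Real.exp_le_one_iff.2 (by linarith))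
    · simp [hk, h, lapSymbol_nonneg]
  have hke : ∀ τ, ‖(k τ : ℂ)‖ₑ = lagDensity I ξ τ := by
    intro τ
    by_cases h : τ ∈ I
    · simp only [hk, lagDensity, h, indicator_of_mem]
      rw [← ofReal_norm, Complex.norm_real, norm_neg, Real.norm_of_nonneg
        (by positivity)]
      rfl
    · simp [hk, lagDensity, h]
  have hint : Integrable (fun q : ℝ × Euc n => ((k (t - q.1) : ℝ) : ℂ) *
        (Real.fourierChar (-inner ℝ q.2 ξ) • (a q : ℂ))) (volume.prod volume) := by
    have hc : Continuous fun z : ℝ × Euc n => (Real.fourierChar (-inner ℝ z.2 ξ) : ℂ) :=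
      (continuous_subtype_val.comp Real.continuous_fourierChar).comp (by fun_prop)
    have hm1 : Measurable fun q : ℝ × Euc n => ((k (t - q.1) : ℝ) : ℂ) :=
      Complex.measurable_ofReal.comp (hkm.comp (by fun_prop))
    have hm2 : Measurable fun q : ℝ × Euc n => (a q : ℂ) :=
      Complex.measurable_ofReal.comp ha.meas
    refine (ha.int.abs.const_mul (lapSymbol ξ)).mono'
      (hm1.mul (hc.measurable.mul hm2)).aestronglyMeasurable (ae_of_all _ fun q => ?_)
    rw [norm_mul, Circle.norm_smul, Complex.norm_real, Complex.norm_real]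
    exact mul_le_mul_of_nonneg_right (hkb _) (abs_nonneg _)
  rw [Measure.volume_eq_prod, integral_prod _ hint]
  refine (enorm_integral_le_lintegral_enorm _).trans (lintegral_mono fun s => ?_)
  simp only
  rw [integral_const_mul, enorm_mul, hke, ← Real.fourier_eq]
  rfl

theorem measurable_lagDensity_conv (ha : IsSource a) (hI : MeasurableSet I) :
    Measurable fun p : ℝ × Euc n =>
      (∫⁻ s, lagDensity I p.2 (p.1 - s) * ‖fourierSlice a s p.2‖ₑ) ^ 2 := by
  have h1 : Measurable fun z : (ℝ × Euc n) × ℝ => lagDensity I z.1.2 (z.1.1 - z.2) :=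
    (measurable_lagDensity (n := n) hI).comp
      (g := fun p : Euc n × ℝ => lagDensity I p.1 p.2)
      (f := fun z : (ℝ × Euc n) × ℝ => (z.1.2, z.1.1 - z.2)) (by fun_prop)
  have h2 : Measurable fun z : (ℝ × Euc n) × ℝ => fourierSlice a z.2 z.1.2 :=
    ha.measurable_fourierSlice.comp (g := fun p : ℝ × Euc n => fourierSlice a p.1 p.2)
      (f := fun z : (ℝ × Euc n) × ℝ => (z.2, z.1.2)) (by fun_prop)
  exact (Measurable.lintegral_prod_right' (h1.mul h2.enorm)).pow_const 2

theorem lintegral_lagDensity_conv_sq_le (ha : IsSource a) (hI : MeasurableSet I) (ξ : Euc n) :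
    ∫⁻ t, (∫⁻ s, lagDensity I ξ (t - s) * ‖fourierSlice a s ξ‖ₑ) ^ 2 ≤
      (∫⁻ τ, lagDensity I ξ τ) ^ 2 * specMass a ξ := by
  have h1 : Measurable (lagDensity I ξ) :=
    (measurable_lagDensity (n := n) hI).comp (g := fun p : Euc n × ℝ => lagDensity I p.1 p.2)
      (f := fun τ : ℝ => (ξ, τ)) (by fun_prop)
  have h2 : Measurable fun s => fourierSlice a s ξ :=
    ha.measurable_fourierSlice.comp (g := fun p : ℝ × Euc n => fourierSlice a p.1 p.2)
      (f := fun s : ℝ => (s, ξ)) (by fun_prop)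
  exact lintegral_sq_conv_le h1 h2.enorm

/-- The `L²` bound for the truncated maximal regularity operators. -/
theorem lintegral_maxReg_sq_le (ha : IsSource a) (hI : MeasurableSet I) (hε : 0 < ε)
    (hIε : I ⊆ Ioi ε) :
    ∫⁻ p, ‖maxReg I a p‖ₑ ^ 2 ≤ ∫⁻ ξ, (∫⁻ τ, lagDensity I ξ τ) ^ 2 * specMass a ξ := by
  have hm : Measurable (maxReg I a) := ha.measurable_maxReg hI
  rw [Measure.volume_eq_prod, lintegral_prod _ (hm.enorm.pow_const 2).aemeasurable]
  have h1 : ∀ t, ∫⁻ x, ‖maxReg I a (t, x)‖ₑ ^ 2 ≤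
      ∫⁻ ξ, (∫⁻ s, lagDensity I ξ (t - s) * ‖fourierSlice a s ξ‖ₑ) ^ 2 := by
    intro t
    rw [← lintegral_fourier_ofReal_sq (ha.integrable_slice hI hε hIε t)
      (ha.memLp_slice hI hε hIε t)]
    refine lintegral_mono fun ξ => ?_
    exact pow_le_pow_left' (ha.enorm_fourier_maxReg_le hI hε hIε t ξ) 2
  refine (lintegral_mono h1).trans ?_
  rw [lintegral_lintegral_swap (ha.measurable_lagDensity_conv hI).aemeasurable]
  exact lintegral_mono fun ξ => ha.lintegral_lagDensity_conv_sq_le hI ξ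

theorem lintegral_specMass (ha : IsSource a) : ∫⁻ ξ, specMass a ξ = ∫⁻ q, ‖a q‖ₑ ^ 2 := by
  obtain ⟨M, hM⟩ := ha.bdd
  calc ∫⁻ ξ, specMass a ξ = ∫⁻ s, ∫⁻ ξ, ‖fourierSlice a s ξ‖ₑ ^ 2 :=
        (lintegral_lintegral_swap
          (ha.measurable_fourierSlice.enorm.pow_const 2).aemeasurable).symm
    _ = ∫⁻ s, ∫⁻ y, ‖a (s, y)‖ₑ ^ 2 := by
        refine lintegral_congr_ae ?_
        filter_upwards [Integrable.prod_right_ae (μ := volume) (ν := volume) ha.int] with s hs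
        exact lintegral_fourier_ofReal_sq hs
          (memLp_two_of_integrable_of_bounded hs fun y => hM (s, y))
    _ = _ := by
        rw [Measure.volume_eq_prod, lintegral_prod _ (ha.meas.enorm.pow_const 2).aemeasurable]

end IsSource

theorem eLpNorm_two_sq {α : Type*} [MeasurableSpace α] {μ : Measure α} (f : α → ℝ) :
    eLpNorm f 2 μ ^ 2 = ∫⁻ x, ‖f x‖ₑ ^ 2 ∂μ := by
  rw [eLpNorm_eq_lintegral_rpow_enorm_toReal two_ne_zero ENNReal.ofNat_ne_top]
  simp only [ENNReal.toReal_ofNat, ENNReal.rpow_ofNat]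
  rw [← ENNReal.rpow_natCast, ← ENNReal.rpow_mul]
  norm_num

theorem ae_tendsto_zero_of_tsum_lintegral_ne_top {α : Type*} [MeasurableSpace α] {μ : Measure α}
    {f : ℕ → α → ENNReal} (hf : ∀ k, Measurable (f k)) (h : ∑' k, ∫⁻ x, f k x ∂μ ≠ ⊤) :
    ∀ᵐ x ∂μ, Tendsto (fun k => f k x) atTop (nhds 0) := by
  rw [← lintegral_tsum fun k => (hf k).aemeasurable] at h
  filter_upwards [ae_lt_top (Measurable.tsum hf) h] with x hx
  exact ENNReal.tendsto_atTop_zero_of_tsum_ne_top hx.ne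

namespace IsSource

variable {n : ℕ} {a : ℝ × Euc n → ℝ} {I : Set ℝ} {ε : ℝ}

theorem maxReg_Ioi_sub (ha : IsSource a) {δ : ℝ} (hδ : 0 < δ) (h : δ ≤ ε) (p : ℝ × Euc n) :
    maxReg (Ioi δ) a p - maxReg (Ioi ε) a p = maxReg (Ioc δ ε) a p := by
  simp only [maxReg]
  rw [← integral_sub (ha.integrable_integrand measurableSet_Ioi hδ le_rfl p)
    (ha.integrable_integrand measurableSet_Ioi (hδ.trans_le h) le_rfl p)]
  congr 1 with q
  rw [← sub_mul]
  congr 1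
  simp only [mrKernel, indicator, mem_Ioi, mem_Ioc]
  split_ifs <;> first | (exfalso; grind) | simp

theorem memLp_two (ha : IsSource a) : MemLp a 2 :=
  let ⟨_, hM⟩ := ha.bdd
  memLp_two_of_integrable_of_bounded ha.int hM

theorem lintegral_sq_ne_top (ha : IsSource a) : ∫⁻ q, ‖a q‖ₑ ^ 2 ≠ ⊤ := by
  rw [← eLpNorm_two_sq]
  exact ENNReal.pow_ne_top ha.memLp_two.2.ne

theorem eLpNorm_maxReg_le (ha : IsSource a) (hI : MeasurableSet I) (hε : 0 < ε)
    (hIε : I ⊆ Ioi ε) : eLpNorm (maxReg I a) 2 ≤ eLpNorm a 2 := by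
  rw [← ENNReal.pow_le_pow_left_iff two_ne_zero, eLpNorm_two_sq, eLpNorm_two_sq,
    ← ha.lintegral_specMass]
  refine (ha.lintegral_maxReg_sq_le hI hε hIε).trans (lintegral_mono fun ξ => ?_)
  exact mul_le_of_le_one_left' (pow_le_one₀ zero_le
    (lintegral_lagDensity_le_one hI (hIε.trans (Ioi_subset_Ioi hε.le)) ξ))

/-- The `L²` modulus of convergence of the truncated maximal regularity operators. -/
def lagTail {n : ℕ} (a : ℝ × Euc n → ℝ) (ε : ℝ) : ENNReal :=
  ∫⁻ ξ, min 1 (ENNReal.ofReal (lapSymbol ξ * ε)) ^ 2 * specMass a ξ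

theorem lagTail_mono {δ : ℝ} (h : δ ≤ ε) : lagTail a δ ≤ lagTail a ε := by
  unfold lagTail
  gcongr with ξ
  exact lapSymbol_nonneg ξ

theorem tendsto_lagTail (ha : IsSource a) {e : ℕ → ℝ} (he : Tendsto e atTop (nhds 0)) :
    Tendsto (fun k => lagTail a (e k)) atTop (nhds 0) := by
  have hfin : ∫⁻ ξ, specMass a ξ ≠ ⊤ := by
    rw [ha.lintegral_specMass]
    exact ha.lintegral_sq_ne_top
  have hw := continuous_lapSymbol (n := n)
  rw [← lintegral_zero (μ := (volume : Measure (Euc n)))]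
  refine tendsto_lintegral_of_dominated_convergence (specMass a) (fun k => ?_)
    (fun k => ae_of_all _ fun ξ => ?_) hfin ?_
  · exact (by fun_prop : Measurable fun ξ : Euc n =>
      min 1 (ENNReal.ofReal (lapSymbol ξ * e k)) ^ 2).mul ha.measurable_specMass
  · exact mul_le_of_le_one_left' (pow_le_one₀ zero_le (min_le_left _ _))
  · filter_upwards [ae_lt_top ha.measurable_specMass hfin] with ξ hξ
    have h1 : Tendsto (fun k => ENNReal.ofReal (lapSymbol ξ * e k)) atTop (nhds 0) := by
      have := ENNReal.tendsto_ofReal (he.const_mul (lapSymbol ξ))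
      simpa using this
    have h2 : Tendsto (fun k => min 1 (ENNReal.ofReal (lapSymbol ξ * e k))) atTop (nhds 0) :=
      tendsto_of_tendsto_of_tendsto_of_le_of_le tendsto_const_nhds h1 (fun _ => zero_le)
        fun _ => min_le_right _ _
    have h3 := ENNReal.Tendsto.mul_const (ENNReal.Tendsto.pow (n := 2) h2) (Or.inr hξ.ne)
    simpa using h3

theorem eLpNorm_maxReg_sub_sq_le (ha : IsSource a) {δ : ℝ} (hδ : 0 < δ) (h : δ ≤ ε) :
    eLpNorm (maxReg (Ioi δ) a - maxReg (Ioi ε) a) 2 ^ 2 ≤ lagTail a ε := by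
  have h1 : maxReg (Ioi δ) a - maxReg (Ioi ε) a = maxReg (Ioc δ ε) a :=
    funext fun p => ha.maxReg_Ioi_sub hδ h p
  rw [h1, eLpNorm_two_sq]
  refine (ha.lintegral_maxReg_sq_le measurableSet_Ioc hδ Ioc_subset_Ioi_self).trans
    (lintegral_mono fun ξ => ?_)
  refine mul_le_mul_left (pow_le_pow_left' (le_min ?_ ?_) 2) _
  · exact lintegral_lagDensity_le_one measurableSet_Ioc
      (Ioc_subset_Ioi_self.trans (Ioi_subset_Ioi hδ.le)) ξ
  · exact lintegral_lagDensity_le_mul measurableSet_Ioc (Ioc_subset_Ioc_left hδ.le) ξ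

/-- Convergence of the truncated maximal regularity operators in `L²`. -/
theorem exists_tendsto_eLpNorm (ha : IsSource a) {e : ℕ → ℝ} (hpos : ∀ k, 0 < e k)
    (hanti : Antitone e) (he : Tendsto e atTop (nhds 0)) :
    ∃ g : ℝ × Euc n → ℝ, Measurable g ∧ eLpNorm g 2 ≤ eLpNorm a 2 ∧
      Tendsto (fun k => eLpNorm (maxReg (Ioi (e k)) a - g) 2) atTop (nhds 0) := by
  have hmem : ∀ k, MemLp (maxReg (Ioi (e k)) a) 2 := fun k =>
    ⟨(ha.measurable_maxReg measurableSet_Ioi).aestronglyMeasurable,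
      (ha.eLpNorm_maxReg_le measurableSet_Ioi (hpos k) le_rfl).trans_lt ha.memLp_two.2⟩
  have hcauchy : CauchySeq fun k => (hmem k).toLp := by
    rw [EMetric.cauchySeq_iff_le_tendsto_0]
    refine ⟨fun N => lagTail a (e N) ^ (1 / 2 : ℝ), fun k l N hk hl => ?_, ?_⟩
    · wlog hkl : k ≤ l generalizing k l
      · rw [edist_comm]
        exact this l k hl hk (le_of_not_ge hkl)
      rw [edist_comm, Lp.edist_def,
        eLpNorm_congr_ae ((hmem l).coeFn_toLp.sub (hmem k).coeFn_toLp),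
        one_div, ENNReal.le_rpow_inv_iff two_pos, ENNReal.rpow_ofNat]
      exact (ha.eLpNorm_maxReg_sub_sq_le (hpos l) (hanti hkl)).trans (lagTail_mono (hanti hk))
    · have := (ENNReal.continuous_rpow_const (y := 1 / 2)).tendsto 0 |>.comp
        (ha.tendsto_lagTail he)
      simpa [Function.comp_def] using this
  obtain ⟨G, hG⟩ := cauchySeq_tendsto_of_complete hcauchy
  refine ⟨G, (Lp.stronglyMeasurable G).measurable, ?_, ?_⟩
  · rw [← Lp.enorm_def]
    refine le_of_tendsto' hG.enorm fun k => ?_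
    rw [Lp.enorm_def, eLpNorm_congr_ae (hmem k).coeFn_toLp]
    exact ha.eLpNorm_maxReg_le measurableSet_Ioi (hpos k) le_rfl
  · rw [tendsto_iff_edist_tendsto_0] at hG
    refine hG.congr fun k => ?_
    rw [Lp.edist_def]
    exact eLpNorm_congr_ae ((hmem k).coeFn_toLp.sub EventuallyEq.rfl)

/-- A subsequence of the truncated maximal regularity operators converges almost everywhere and
in `L²` on almost every time slice. -/
theorem exists_limit (ha : IsSource a) :
    ∃ (g : ℝ × Euc n → ℝ) (e : ℕ → ℝ), Measurable g ∧ eLpNorm g 2 ≤ eLpNorm a 2 ∧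
      (∀ k, 0 < e k) ∧ Tendsto e atTop (nhds 0) ∧
      (∀ᵐ p, Tendsto (fun k => maxReg (Ioi (e k)) a p) atTop (nhds (g p))) ∧
      ∀ᵐ t, Tendsto (fun k => eLpNorm (fun x => maxReg (Ioi (e k)) a (t, x) - g (t, x)) 2)
        atTop (nhds 0) := by
  obtain ⟨g, hgm, hg2, hg⟩ := ha.exists_tendsto_eLpNorm (e := fun k : ℕ => 1 / ((k : ℝ) + 1))
    (fun k => by positivity) (fun i j h => by simp only; gcongr)
    tendsto_one_div_add_atTop_nhds_zero_nat
  have hev : ∀ N : ℕ, ∀ᶠ k : ℕ in atTop, eLpNorm (maxReg (Ioi (1 / ((k : ℝ) + 1))) a - g) 2 ^ 2 <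
      (2⁻¹ : ENNReal) ^ N := by
    intro N
    have h2 := ENNReal.Tendsto.pow (n := 2) hg
    rw [zero_pow two_ne_zero] at h2
    exact h2.eventually_lt_const (by simp [pos_iff_ne_zero])
  obtain ⟨σ, hσ, hlt⟩ := extraction_forall_of_eventually hev
  have hm : ∀ k, Measurable fun p => ‖maxReg (Ioi (1 / ((σ k : ℝ) + 1))) a p - g p‖ₑ ^ 2 :=
    fun k => (((ha.measurable_maxReg measurableSet_Ioi).sub hgm).enorm.pow_const 2)
  have hsum : ∑' k, ∫⁻ p, ‖maxReg (Ioi (1 / ((σ k : ℝ) + 1))) a p - g p‖ₑ ^ 2 ≠ ⊤ := by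
    refine ne_top_of_le_ne_top (b := ∑' k : ℕ, (2⁻¹ : ENNReal) ^ k) ?_
      (ENNReal.tsum_le_tsum fun k => ?_)
    · rw [ENNReal.tsum_geometric]
      simp
    · have := (hlt k).le
      rwa [eLpNorm_two_sq] at this
  have hsq : ∀ {u : ℕ → ENNReal}, Tendsto (fun k => u k ^ 2) atTop (nhds 0) →
      Tendsto u atTop (nhds 0) := by
    intro u hu
    have := ((ENNReal.continuous_rpow_const (y := 1 / 2)).tendsto 0).comp hu
    refine (this.congr fun k => ?_).trans (by simp)
    simp only [Function.comp]
    rw [← ENNReal.rpow_natCast, ← ENNReal.rpow_mul]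
    norm_num
  refine ⟨g, fun k => 1 / ((σ k : ℝ) + 1), hgm, hg2, fun k => by positivity,
    tendsto_one_div_add_atTop_nhds_zero_nat.comp hσ.tendsto_atTop, ?_, ?_⟩
  · filter_upwards [ae_tendsto_zero_of_tsum_lintegral_ne_top hm hsum] with p hp
    rw [tendsto_iff_edist_tendsto_0]
    refine (hsq hp).congr fun k => ?_
    rw [edist_eq_enorm_sub]
  · have h3 : ∀ k, ∫⁻ p, ‖maxReg (Ioi (1 / ((σ k : ℝ) + 1))) a p - g p‖ₑ ^ 2 =
        ∫⁻ t, ∫⁻ x, ‖maxReg (Ioi (1 / ((σ k : ℝ) + 1))) a (t, x) - g (t, x)‖ₑ ^ 2 := fun k => by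
      rw [Measure.volume_eq_prod, lintegral_prod _ (hm k).aemeasurable]
    simp only [h3] at hsum
    filter_upwards [ae_tendsto_zero_of_tsum_lintegral_ne_top
      (fun k => (hm k).lintegral_prod_right') hsum] with t ht
    refine hsq (ht.congr fun k => ?_)
    rw [eLpNorm_two_sq]

end IsSource

/-- The value at `(t, q)` of the heat evolution of the test function `ψ`. -/
def heatPairing {n : ℕ} (t : ℝ) (ψ : Euc n → ℝ) (q : ℝ × Euc n) : ℝ :=
  ∫ x, heatKernel n (t - q.1) (x - q.2) * ψ x

section

variable {n : ℕ} {ψ : Euc n → ℝ} {L : ℝ}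

theorem measurable_heatPairing (t : ℝ) (hψ : Measurable ψ) : Measurable (heatPairing t ψ) := by
  have h : Measurable fun z : (ℝ × Euc n) × Euc n =>
      heatKernel n (t - z.1.1) (z.2 - z.1.2) * ψ z.2 :=
    ((measurable_heatKernel n).comp (g := fun p : ℝ × Euc n => heatKernel n p.1 p.2)
      (f := fun z : (ℝ × Euc n) × Euc n => (t - z.1.1, z.2 - z.1.2)) (by fun_prop)).mul
      (hψ.comp measurable_snd)
  exact h.stronglyMeasurable.integral_prod_right.measurable

theorem abs_heatPairing_le {t : ℝ} (hL : ∀ x, |ψ x| ≤ L) {q : ℝ × Euc n} (hq : q.1 < t) :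
    |heatPairing t ψ q| ≤ L := by
  have ht : 0 < t - q.1 := sub_pos.2 hq
  have h1 : ∫ x, heatKernel n (t - q.1) (x - q.2) * L = L := by
    rw [integral_mul_const, integral_sub_right_eq_self (heatKernel n (t - q.1)),
      integral_heatKernel ht, one_mul]
  refine (norm_integral_le_of_norm_le (f := fun x => heatKernel n (t - q.1) (x - q.2) * ψ x)
    (((integrable_heatKernel ht).comp_sub_right q.2).mul_const L)
    (ae_of_all _ fun x => ?_)).trans h1.le
  rw [norm_mul, Real.norm_of_nonneg (heatKernel_nonneg n ht.le _)]
  exact mul_le_mul_of_nonneg_left (hL x) (heatKernel_nonneg n ht.le _)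

end

namespace IsSource

variable {n : ℕ} {a : ℝ × Euc n → ℝ} {I : Set ℝ} {ε L : ℝ} {ψ φ : Euc n → ℝ}

/-- Fubini's theorem for the Duhamel integral tested against `ψ`. -/
theorem integral_duhamel_mul (ha : IsSource a) (t : ℝ) (hψ : Measurable ψ)
    (hL : ∀ x, |ψ x| ≤ L) :
    ∫ x, (∫ q in Ioo (0 : ℝ) t ×ˢ (univ : Set (Euc n)),
        heatKernel n (t - q.1) (x - q.2) * a q ∂(pmeas volume)) * ψ x =
      ∫ q in {q | q.1 < t}, heatPairing t ψ q * a q := by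
  have hmS : MeasurableSet {q : ℝ × Euc n | q.1 < t} :=
    measurableSet_lt measurable_fst measurable_const
  have h1 : ∀ x, ∫ q in Ioo (0 : ℝ) t ×ˢ (univ : Set (Euc n)),
        heatKernel n (t - q.1) (x - q.2) * a q ∂(pmeas volume) =
      ∫ q in {q : ℝ × Euc n | q.1 < t}, heatKernel n (t - q.1) (x - q.2) * a q := by
    intro x
    change ∫ q in _, _ ∂(volume : Measure (ℝ × Euc n)) = _
    rw [← integral_indicator (measurableSet_Ioo.prod MeasurableSet.univ), ← integral_indicator hmS]
    congr 1 with q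
    by_cases h0 : q.1 ≤ 0
    · simp [indicator, ha.zero q h0]
    · simp [indicator, not_le.1 h0]
  simp_rw [h1, ← integral_mul_const]
  rw [integral_integral_swap]
  · congr 1 with q
    rw [heatPairing, ← integral_mul_const]
    congr 1 with x
    ring
  · have hm : Measurable fun z : Euc n × (ℝ × Euc n) => heatKernel n (t - z.2.1) (z.1 - z.2.2) :=
      (measurable_heatKernel n).comp (g := fun p : ℝ × Euc n => heatKernel n p.1 p.2)
        (f := fun z : Euc n × (ℝ × Euc n) => (t - z.2.1, z.1 - z.2.2)) (by fun_prop)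
    have hma : Measurable fun z : Euc n × (ℝ × Euc n) => a z.2 := ha.meas.comp measurable_snd
    have key : Integrable (fun z : Euc n × (ℝ × Euc n) =>
        heatKernel n (t - z.2.1) (z.1 - z.2.2) * a z.2)
        (volume.prod (volume.restrict {q : ℝ × Euc n | q.1 < t})) := by
      refine (integrable_prod_iff' (hm.mul hma).aestronglyMeasurable).2 ⟨?_, ?_⟩
      · refine (ae_restrict_iff' hmS).2 (ae_of_all _ fun q hq => ?_)
        have := ((integrable_heatKernel (sub_pos.2 hq)).comp_sub_right q.2).mul_const (a q)
        exact this
      · refine ha.int.abs.integrableOn.congr ((ae_restrict_iff' hmS).2 (ae_of_all _ fun q hq => ?_))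
        have ht : 0 < t - q.1 := sub_pos.2 hq
        simp only [Pi.mul_apply, norm_mul, Real.norm_eq_abs, abs_of_nonneg (heatKernel_nonneg n ht.le _)]
        rw [integral_mul_const, integral_sub_right_eq_self (heatKernel n (t - q.1)),
          integral_heatKernel ht, one_mul]
    exact key.mul_bdd (c := L) (hψ.comp measurable_fst).aestronglyMeasurable
      (ae_of_all _ fun z => hL z.1)

/-- The truncated operators are truncated Duhamel integrals of the Laplacian. -/
theorem integral_maxReg_mul (ha : IsSource a) (hε : 0 < ε) (t : ℝ) (hφ : ContDiff ℝ 2 φ)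
    (hc : HasCompactSupport φ) :
    ∫ x, maxReg (Ioi ε) a (t, x) * φ x =
      ∫ q in {q | q.1 < t - ε}, heatPairing t (lapl φ) q * a q := by
  obtain ⟨L, hL⟩ := hc.exists_bound_of_continuous hφ.continuous
  have hmS : MeasurableSet {q : ℝ × Euc n | q.1 < t - ε} :=
    measurableSet_lt measurable_fst measurable_const
  simp_rw [maxReg, ← integral_mul_const]
  rw [integral_integral_swap, ← integral_indicator hmS]
  · congr 1 with q
    have h1 : ∀ x, mrKernel n (Ioi ε) ((t, x).1 - q.1) ((t, x).2 - q.2) * a q * φ x =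
        mrKernel n (Ioi ε) (t - q.1) (x - q.2) * φ x * a q := fun x => by ring
    simp_rw [h1]
    rw [integral_mul_const]
    by_cases hq : q.1 < t - ε
    · have : t - q.1 ∈ Ioi ε := by simp only [mem_Ioi]; linarith
      simp only [mrKernel, this, indicator, mem_ofPred_eq, hq, if_true]
      rw [integral_lapKernel_mul _ _ hφ hc, heatPairing]
    · have : t - q.1 ∉ Ioi ε := by simp only [mem_Ioi]; linarith
      simp [mrKernel, this, hq]
  · exact (ha.integrable_prod measurableSet_Ioi hε le_rfl t).mul_bdd (c := L)
      (hφ.continuous.comp continuous_fst).aestronglyMeasurable (ae_of_all _ fun z => hL z.1)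

theorem tendsto_integral_maxReg_mul (ha : IsSource a) {e : ℕ → ℝ} (hpos : ∀ k, 0 < e k)
    (he : Tendsto e atTop (nhds 0)) (t : ℝ) (hφ : ContDiff ℝ 2 φ) (hc : HasCompactSupport φ) :
    Tendsto (fun k => ∫ x, maxReg (Ioi (e k)) a (t, x) * φ x) atTop
      (nhds (∫ q in {q | q.1 < t}, heatPairing t (lapl φ) q * a q)) := by
  obtain ⟨L, hL⟩ := (hasCompactSupport_lapl hc).exists_bound_of_continuous (continuous_lapl hφ)
  have hmS : ∀ s : ℝ, MeasurableSet {q : ℝ × Euc n | q.1 < s} := fun s =>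
    measurableSet_lt measurable_fst measurable_const
  have hmH := (measurable_heatPairing t (continuous_lapl hφ).measurable).mul ha.meas
  simp_rw [fun k => ha.integral_maxReg_mul (hpos k) t hφ hc, ← integral_indicator (hmS _)]
  refine tendsto_integral_of_dominated_convergence (fun q => L * |a q|)
    (fun k => (hmH.indicator (hmS _)).aestronglyMeasurable) (ha.int.abs.const_mul L)
    (fun k => ae_of_all _ fun q => ?_) (ae_of_all _ fun q => ?_)
  · by_cases hq : q.1 < t - e k
    · simp only [indicator, mem_ofPred_eq, hq, if_true, norm_mul]
      exact mul_le_mul_of_nonneg_right (abs_heatPairing_le hL (by linarith [hpos k])) (abs_nonneg _)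
    · have : 0 ≤ L := (norm_nonneg _).trans (hL 0)
      simp only [indicator, mem_ofPred_eq, hq, if_false, norm_zero]
      positivity
  · by_cases hq : q.1 < t
    · refine tendsto_const_nhds.congr' ?_
      have : ∀ᶠ k in atTop, e k < t - q.1 := he.eventually_lt_const (sub_pos.2 hq)
      filter_upwards [this] with k hk
      have : q.1 < t - e k := by linarith
      simp [indicator, hq, this]
    · refine tendsto_const_nhds.congr fun k => ?_
      have : ¬ q.1 < t - e k := by linarith [hpos k]
      simp [indicator, hq, this]

end IsSource

theorem tendsto_integral_mul_of_tendsto_eLpNorm_two {α : Type*} [MeasurableSpace α] {μ : Measure α}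
    {F : ℕ → α → ℝ} {g φ : α → ℝ} (hF : ∀ k, MemLp (F k) 2 μ) (hg : AEStronglyMeasurable g μ)
    (hφ : MemLp φ 2 μ) (h : Tendsto (fun k => eLpNorm (fun x => F k x - g x) 2 μ) atTop (nhds 0)) :
    Tendsto (fun k => ∫ x, F k x * φ x ∂μ) atTop (nhds (∫ x, g x * φ x ∂μ)) := by
  refine tendsto_integral_of_L1' _ (hg.mul hφ.1)
    (Eventually.of_forall fun k => (hF k).integrable_mul hφ) ?_
  have h2 : Tendsto (fun k => eLpNorm (fun x => F k x - g x) 2 μ * eLpNorm φ 2 μ) atTop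
      (nhds 0) := by
    simpa using ENNReal.Tendsto.mul_const h (Or.inr hφ.2.ne)
  refine tendsto_of_tendsto_of_tendsto_of_le_of_le tendsto_const_nhds h2 (fun _ => zero_le)
    fun k => ?_
  have h3 := eLpNorm_smul_le_mul_eLpNorm (r := 1) (p := 2) (q := 2) hφ.1 ((hF k).1.sub hg)
  refine le_trans (eLpNorm_congr_ae (ae_of_all _ fun x => ?_)).le h3
  simp [sub_mul]

namespace IsSource

variable {n : ℕ} {a : ℝ × Euc n → ℝ} {φ : Euc n → ℝ}

/-- On time slices where the truncations converge, the limit is the distributional Laplacian of the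
Duhamel integral. -/
theorem integral_limit_mul (ha : IsSource a) {g : ℝ × Euc n → ℝ} (hg : Measurable g) {e : ℕ → ℝ}
    (hpos : ∀ k, 0 < e k) (he : Tendsto e atTop (nhds 0)) {t : ℝ}
    (h : Tendsto (fun k => eLpNorm (fun x => maxReg (Ioi (e k)) a (t, x) - g (t, x)) 2)
        atTop (nhds 0)) (hφ : ContDiff ℝ 2 φ) (hc : HasCompactSupport φ) :
    ∫ x, g (t, x) * φ x = ∫ q in {q | q.1 < t}, heatPairing t (lapl φ) q * a q :=
  tendsto_nhds_unique (tendsto_integral_mul_of_tendsto_eLpNorm_two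
    (fun k => ha.memLp_slice measurableSet_Ioi (hpos k) le_rfl t)
    (hg.comp (by fun_prop : Measurable fun x : Euc n => (t, x))).aestronglyMeasurable
    (hφ.continuous.memLp_of_hasCompactSupport hc) h)
    (ha.tendsto_integral_maxReg_mul hpos he t hφ hc)

end IsSource

/-- The constant in the pointwise decay of the maximal regularity operator on atoms. -/
def decayConst (n : ℕ) : ℝ :=
  2 ^ (n + 3) * (n + 3) ^ 2 * 2 * gaussConst n + (n + 1) * gaussConst n * 3 * (4 / 3) ^ (n + 3)

theorem decayConst_pos (n : ℕ) : 0 < decayConst n := by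
  have := gaussConst_pos n
  unfold decayConst; positivity

namespace IsSource

variable {n : ℕ} {a : ℝ × Euc n → ℝ} {ε r : ℝ} {c p : ℝ × Euc n}

theorem abs_maxReg_le_of_late (ha : IsSource a) (hr : 0 < r)
    (hsupp : ∀ q, q ∉ pball c r → a q = 0) (h0 : ∫ q, a q = 0) (h1 : ∫ q, |a q| ≤ 1)
    (hε : 0 < ε) (hεr : ε ≤ 3 * r ^ 2) (hp : 4 * r ^ 2 ≤ p.1 - c.1) :
    |maxReg (Ioi ε) a p| ≤
      2 ^ (n + 3) * (n + 3) ^ 2 * 2 * gaussConst n * r / pdist p c ^ (n + 3) := by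
  have hD : pdist p c = max √(p.1 - c.1) ‖p.2 - c.2‖ := by
    rw [pdist, abs_of_nonneg (by nlinarith), dist_eq_norm]
  set K := 2 ^ (n + 3) * (n + 3) ^ 2 * 2 * gaussConst n * r / pdist p c ^ (n + 3) with hK
  have hK0 : 0 ≤ K := by
    have := gaussConst_pos n
    have : 0 ≤ pdist p c := le_max_of_le_left (Real.sqrt_nonneg _)
    positivity
  have h2 : maxReg (Ioi ε) a p = ∫ q, (mrKernel n (Ioi ε) (p.1 - q.1) (p.2 - q.2) * a q -
      lapKernel n (p.1 - c.1) (p.2 - c.2) * a q) := by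
    rw [integral_sub (ha.integrable_integrand measurableSet_Ioi hε le_rfl p)
      (ha.int.const_mul _), integral_const_mul, h0, mul_zero, sub_zero, maxReg]
  rw [h2]
  refine (norm_integral_le_of_norm_le
    (f := fun q => mrKernel n (Ioi ε) (p.1 - q.1) (p.2 - q.2) * a q -
      lapKernel n (p.1 - c.1) (p.2 - c.2) * a q) (ha.int.abs.const_mul K) (ae_of_all _ fun q => ?_)).trans ?_
  · by_cases hq : q ∈ pball c r
    · rw [pball_eq_prod c hr, mem_prod, mem_ball, mem_ball, Real.dist_eq, dist_eq_norm] at hq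
      have hq1 := abs_lt.1 hq.1
      have hmem : p.1 - q.1 ∈ Ioi ε := by simp only [mem_Ioi]; linarith
      rw [← sub_mul, norm_mul]
      refine mul_le_mul_of_nonneg_right ?_ (abs_nonneg _)
      simp only [mrKernel, hmem, indicator_of_mem]
      have := abs_lapKernel_sub_le (n := n) hr hp (d := c.1 - q.1) (w := c.2 - q.2)
        (z := p.2 - c.2) (by rw [abs_sub_comm]; exact hq.1.le)
        (by rw [norm_sub_rev]; exact hq.2.le)
      rw [show p.1 - c.1 + (c.1 - q.1) = p.1 - q.1 by ring,
        show p.2 - c.2 + (c.2 - q.2) = p.2 - q.2 by abel, ← hD] at this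
      exact this
    · simp [hsupp q hq]
  · rw [integral_const_mul]
    exact mul_le_of_le_one_right hK0 h1

theorem abs_maxReg_le_of_early (ha : IsSource a) (hr : 0 < r)
    (hsupp : ∀ q, q ∉ pball c r → a q = 0) (h1 : ∫ q, |a q| ≤ 1)
    (hε : 0 < ε) (hp : p.1 - c.1 < 4 * r ^ 2) (hpd : 4 * r ≤ pdist p c) :
    |maxReg (Ioi ε) a p| ≤
      (n + 1) * gaussConst n * 3 * (4 / 3) ^ (n + 3) * r / pdist p c ^ (n + 3) := by
  have hG := gaussConst_pos n
  have hD0 : 0 < pdist p c := by linarith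
  set K := (n + 1) * gaussConst n * 3 * (4 / 3) ^ (n + 3) * r / pdist p c ^ (n + 3) with hK
  have hK0 : 0 ≤ K := by positivity
  refine (norm_integral_le_of_norm_le
    (f := fun q => mrKernel n (Ioi ε) (p.1 - q.1) (p.2 - q.2) * a q) (ha.int.abs.const_mul K) (ae_of_all _ fun q => ?_)).trans ?_
  · by_cases hq : q ∈ pball c r
    · rw [pball_eq_prod c hr, mem_prod, mem_ball, mem_ball, Real.dist_eq, dist_eq_norm] at hq
      have hq1 := abs_lt.1 hq.1
      rw [norm_mul]
      refine mul_le_mul_of_nonneg_right ?_ (abs_nonneg _)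
      by_cases hmem : p.1 - q.1 ∈ Ioi ε
      · have hτ : 0 < p.1 - q.1 := hε.trans hmem
        simp only [mrKernel, hmem, indicator_of_mem]
        have hs : √|p.1 - c.1| < 4 * r := by
          rw [Real.sqrt_lt' (by positivity), abs_lt]
          constructor <;> nlinarith
        have hz : pdist p c = ‖p.2 - c.2‖ := by
          rw [pdist, dist_eq_norm, max_eq_right]
          rw [pdist, dist_eq_norm] at hpd
          rcases le_max_iff.1 hpd with h | h <;> linarith
        have hle : 3 / 4 * pdist p c ≤ max √(p.1 - q.1) ‖p.2 - q.2‖ := by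
          refine le_max_of_le_right ?_
          have := norm_sub_norm_le (p.2 - c.2) (q.2 - c.2)
          rw [sub_sub_sub_cancel_right] at this
          linarith [hq.2]
        refine (abs_lapKernel_le hτ _ (by positivity) hle).trans ?_
        have hsq : √(p.1 - q.1) ≤ 3 * r := Real.sqrt_le_iff.2 ⟨by positivity, by nlinarith⟩
        calc _ ≤ (n + 1) * gaussConst n * (3 * r) / (3 / 4 * pdist p c) ^ (n + 3) := by gcongr
          _ = K := by
            rw [hK, mul_pow, div_eq_div_iff (by positivity) (by positivity)]
            have : (4 / 3 : ℝ) ^ (n + 3) * (3 / 4) ^ (n + 3) = 1 := by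
              rw [← mul_pow]; norm_num
            linear_combination (-(n + 1) * gaussConst n * 3 * r * pdist p c ^ (n + 3)) * this
      · simpa [mrKernel, hmem] using hK0
    · simp [hsupp q hq]
  · rw [integral_const_mul]
    exact mul_le_of_le_one_right hK0 h1

/-- The pointwise decay of the maximal regularity operator on atoms. -/
theorem abs_maxReg_le_decay (ha : IsSource a) (hr : 0 < r)
    (hsupp : ∀ q, q ∉ pball c r → a q = 0) (h0 : ∫ q, a q = 0) (h1 : ∫ q, |a q| ≤ 1)
    (hε : 0 < ε) (hεr : ε ≤ 3 * r ^ 2) (hpd : 4 * r ≤ pdist p c) :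
    |maxReg (Ioi ε) a p| ≤ decayConst n * r / pdist p c ^ (n + 3) := by
  have hG := gaussConst_pos n
  have hD0 : 0 < pdist p c := by linarith
  rcases le_or_gt (4 * r ^ 2) (p.1 - c.1) with h | h
  · refine (ha.abs_maxReg_le_of_late hr hsupp h0 h1 hε hεr h).trans ?_
    gcongr
    exact le_add_of_nonneg_right (by positivity)
  · refine (ha.abs_maxReg_le_of_early hr hsupp h1 hε h hpd).trans ?_
    gcongr
    exact le_add_of_nonneg_left (by positivity)

end IsSource

theorem lapl_comp_smul {n : ℕ} {φ : Euc n → ℝ} (hφ : ContDiff ℝ 2 φ) (R : ℝ) (x : Euc n) :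
    lapl (fun x => φ (R • x)) x = R ^ 2 * lapl φ (R • x) := by
  have h := ContinuousLinearMap.iteratedFDeriv_comp_right (i := 2) (n := 2)
    (R • ContinuousLinearMap.id ℝ (Euc n)) hφ x le_rfl
  have h2 : (φ ∘ (R • ContinuousLinearMap.id ℝ (Euc n))) = fun x => φ (R • x) := by
    ext x; simp
  rw [h2] at h
  unfold lapl
  rw [Finset.mul_sum, h]
  refine Finset.sum_congr rfl fun i _ => ?_
  rw [ContinuousMultilinearMap.compContinuousLinearMap_apply]
  have h3 := (iteratedFDeriv ℝ 2 φ (R • x)).map_smul_univ (fun _ : Fin 2 => R)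
    ![EuclideanSpace.single i 1, EuclideanSpace.single i 1]
  simp only [Finset.prod_const, Finset.card_univ, Fintype.card_fin, smul_eq_mul] at h3
  simp only [FunLike.coe_smul, ContinuousLinearMap.coe_id', Pi.smul_apply, id_eq]
  exact h3

namespace IsSource

variable {n : ℕ} {a : ℝ × Euc n → ℝ}

theorem abs_setIntegral_heatPairing_le (ha : IsSource a) (t : ℝ) {ψ : Euc n → ℝ} {L : ℝ}
    (hL : ∀ x, |ψ x| ≤ L) :
    |∫ q in {q | q.1 < t}, heatPairing t ψ q * a q| ≤ L * ∫ q, |a q| := by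
  have hmS : MeasurableSet {q : ℝ × Euc n | q.1 < t} :=
    measurableSet_lt measurable_fst measurable_const
  have hL0 : 0 ≤ L := (abs_nonneg _).trans (hL 0)
  rw [← integral_const_mul]
  refine (norm_integral_le_of_norm_le (f := fun q => heatPairing t ψ q * a q)
    (ha.int.abs.const_mul L).integrableOn
    ((ae_restrict_iff' hmS).2 (ae_of_all _ fun q hq => ?_))).trans
    (setIntegral_le_integral (ha.int.abs.const_mul L) (ae_of_all _ fun q => by positivity))
  rw [norm_mul]
  exact mul_le_mul_of_nonneg_right (abs_heatPairing_le hL hq) (abs_nonneg _)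

/-- An integrable distributional Laplacian of a Duhamel integral has mean value zero. -/
theorem integral_eq_zero_of_forall_mul (ha : IsSource a) (t : ℝ) {f : Euc n → ℝ}
    (hf : Integrable f)
    (h : ∀ φ : Euc n → ℝ, ContDiff ℝ 2 φ → HasCompactSupport φ →
      ∫ x, f x * φ x = ∫ q in {q | q.1 < t}, heatPairing t (lapl φ) q * a q) :
    ∫ x, f x = 0 := by
  let b : ContDiffBump (0 : Euc n) := ⟨1, 2, one_pos, one_lt_two⟩
  have hb : ContDiff ℝ 2 (b : Euc n → ℝ) := b.contDiff
  obtain ⟨L, hL⟩ := (hasCompactSupport_lapl b.hasCompactSupport).exists_bound_of_continuous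
    (continuous_lapl hb)
  let e : ℕ → ℝ := fun k => 1 / ((k : ℝ) + 1)
  have he0 : ∀ k, 0 < e k := fun k => by positivity
  have he : Tendsto e atTop (nhds 0) := tendsto_one_div_add_atTop_nhds_zero_nat
  have h1 : Tendsto (fun k => ∫ x, f x * b (e k • x)) atTop (nhds (∫ x, f x)) := by
    refine tendsto_integral_of_dominated_convergence (fun x => |f x|)
      (fun k => hf.1.mul (b.continuous.comp (by fun_prop)).aestronglyMeasurable) hf.abs
      (fun k => ae_of_all _ fun x => ?_) (ae_of_all _ fun x => ?_)
    · rw [norm_mul, Real.norm_of_nonneg b.nonneg]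
      exact mul_le_of_le_one_right (norm_nonneg _) b.le_one
    · have hx : Tendsto (fun k => e k • x) atTop (nhds 0) := by
        simpa using he.smul_const x
      refine tendsto_const_nhds.congr' ?_
      filter_upwards [hx.eventually (b.eventuallyEq_one)] with k hk
      simp [hk]
  have h2 : ∀ k, |∫ x, f x * b (e k • x)| ≤ e k ^ 2 * L * ∫ q, |a q| := by
    intro k
    rw [h (fun x => b (e k • x)) (hb.comp (by fun_prop))
      (b.hasCompactSupport.comp_smul (he0 k).ne')]
    refine ha.abs_setIntegral_heatPairing_le t fun x => ?_
    rw [lapl_comp_smul hb, abs_mul, abs_of_nonneg (by positivity)]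
    exact mul_le_mul_of_nonneg_left (hL _) (by positivity)
  have h3 : Tendsto (fun k => e k ^ 2 * L * ∫ q, |a q|) atTop (nhds 0) := by
    simpa using ((he.pow 2).mul_const L).mul_const (∫ q, |a q|)
  exact tendsto_nhds_unique h1 (squeeze_zero_norm h2 h3)

end IsSource

/-- Bounded measurable atoms supported in a parabolic ball of the upper half space. -/
structure IsSourceAtom {n : ℕ} (a : ℝ × Euc n → ℝ) (c : ℝ × Euc n) (r : ℝ) : Prop
    extends IsSource a where
  r_pos : 0 < r
  supp : ∀ q, q ∉ pball c r → a q = 0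
  le : ∀ q, |a q| ≤ 1 / (unitVol n * r ^ (n + 2))
  mean : ∫ q, a q = 0

theorem IsAtom1Inf.exists_isSourceAtom {n : ℕ} {a : ℝ × Euc n → ℝ} {c : ℝ × Euc n} {r : ℝ}
    (h : IsAtom1Inf n a c r) : ∃ b, IsSourceAtom b c r ∧ a =ᵐ[volume] b := by
  obtain ⟨hr, hsupp, hX, hint, h0, hle⟩ := h
  have hv : 0 < unitVol n * r ^ (n + 2) := mul_pos (unitVol_pos n) (by positivity)
  change Integrable a (volume : Measure (ℝ × Euc n)) at hint
  change ∫ p, a p ∂(volume : Measure (ℝ × Euc n)) = 0 at h0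
  rw [pmeas_pball c hr, ← ENNReal.ofReal_inv_of_pos hv, eLpNorm_exponent_top, ← one_div] at hle
  have hae : ∀ᵐ q ∂(volume : Measure (ℝ × Euc n)), |a q| ≤ 1 / (unitVol n * r ^ (n + 2)) := by
    filter_upwards [enorm_ae_le_eLpNormEssSup a volume] with q hq
    have := hq.trans hle
    rwa [← ofReal_norm, ENNReal.ofReal_le_ofReal_iff (by positivity)] at this
  have hb := hint.1.stronglyMeasurable_mk.measurable
  have hS : MeasurableSet (pball c r ∩ {q | |hint.1.mk a q| ≤ 1 / (unitVol n * r ^ (n + 2))}) :=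
    (measurableSet_pball c hr).inter (measurableSet_le (by fun_prop) measurable_const)
  set b := (pball c r ∩ {q | |hint.1.mk a q| ≤ 1 / (unitVol n * r ^ (n + 2))}).indicator
    (hint.1.mk a) with hbdef
  have hab : a =ᵐ[volume] b := by
    filter_upwards [hae, hint.1.ae_eq_mk] with q hq hq'
    by_cases hqS : q ∈ pball c r
    · have hm : q ∈ pball c r ∩ {q | |hint.1.mk a q| ≤ 1 / (unitVol n * r ^ (n + 2))} :=
        ⟨hqS, by rw [mem_ofPred_eq, ← hq']; exact hq⟩
      rw [hbdef, indicator_of_mem hm, hq']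
    · rw [hbdef, indicator_of_notMem fun h => hqS h.1]
      exact Function.notMem_support.1 fun h => hqS (hsupp h)
  have hsb : ∀ q, q ∉ pball c r → b q = 0 := fun q hq => indicator_of_notMem (fun h => hq h.1) _
  have hbl : ∀ q, |b q| ≤ 1 / (unitVol n * r ^ (n + 2)) := by
    intro q
    by_cases hq : q ∈ pball c r ∩ {q | |hint.1.mk a q| ≤ 1 / (unitVol n * r ^ (n + 2))}
    · rw [hbdef, indicator_of_mem hq]
      exact hq.2
    · rw [hbdef, indicator_of_notMem hq, abs_zero]
      positivity
  refine ⟨b, ⟨⟨hb.indicator hS, hint.congr hab, ⟨_, hbl⟩,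
    fun q hq => hsb q fun h => not_lt.2 hq (hX h)⟩, hr, hsb, hbl, ?_⟩, hab⟩
  rw [← integral_congr_ae hab, h0]

namespace IsSourceAtom

variable {n : ℕ} {a : ℝ × Euc n → ℝ} {c : ℝ × Euc n} {r : ℝ}

theorem integral_abs_le_one (ha : IsSourceAtom a c r) : ∫ q, |a q| ≤ 1 := by
  have hr := ha.r_pos
  have hv : 0 < unitVol n * r ^ (n + 2) := mul_pos (unitVol_pos n) (by positivity)
  have hV : volume (pball c r) = ENNReal.ofReal (unitVol n * r ^ (n + 2)) := pmeas_pball c hr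
  rw [← setIntegral_eq_integral_of_forall_compl_eq_zero (s := pball c r)
    fun q hq => by rw [ha.supp q hq, abs_zero]]
  have h := norm_setIntegral_le_of_norm_le_const (μ := volume) (s := pball c r)
    (f := fun q => |a q|) (by rw [hV]; exact ENNReal.ofReal_lt_top)
    (fun q _ => by rw [Real.norm_eq_abs, abs_abs]; exact ha.le q)
  rw [measureReal_def, hV, ENNReal.toReal_ofReal hv.le, one_div_mul_cancel hv.ne'] at h
  exact (le_abs_self _).trans h

theorem exists_limit_isMolecule (ha : IsSourceAtom a c r) :
    ∃ g : ℝ × Euc n → ℝ, IsMolecule ((Xset (Euc n)).indicator g) c r (decayConst n + 1) ∧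
      ∀ᵐ t, ∀ φ : Euc n → ℝ, ContDiff ℝ 2 φ → HasCompactSupport φ →
        ∫ x, g (t, x) * φ x = ∫ q in {q | q.1 < t}, heatPairing t (lapl φ) q * a q := by
  have hr := ha.r_pos
  have hC := decayConst_pos n
  have hX : MeasurableSet (Xset (Euc n)) := measurableSet_lt measurable_const measurable_fst
  obtain ⟨g, e, hg, hg2, hpos, he, hpt, hsl⟩ := ha.exists_limit
  refine ⟨g, ⟨(hg.indicator hX).aestronglyMeasurable, hr, by positivity, ?_, ?_⟩, ?_⟩
  · have h1 : eLpNorm a 2 (pmeas volume) ≤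
        ENNReal.ofReal 1 * (pmeas volume (pball c r)) ^ (-(1 : ℝ) / 2) :=
      eLpNorm_two_le_of_bound hr (fun q hq => by_contra fun h => hq (ha.supp q h))
        (ae_of_all _ ha.le)
    calc _ ≤ eLpNorm g 2 (pmeas volume) := eLpNorm_indicator_le _
      _ ≤ eLpNorm a 2 (pmeas volume) := hg2
      _ ≤ _ := h1
      _ ≤ _ := by gcongr; linarith
  · change ∀ᵐ p ∂(volume : Measure (ℝ × Euc n)), _
    filter_upwards [hpt] with p hp hpd
    have hD : 0 < pdist p c := by linarith
    have h1 : |g p| ≤ decayConst n * r / pdist p c ^ (n + 3) := by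
      refine le_of_tendsto hp.abs ?_
      have : ∀ᶠ k in atTop, e k < 3 * r ^ 2 := he.eventually_lt_const (by positivity)
      filter_upwards [this] with k hk
      exact ha.abs_maxReg_le_decay hr ha.supp ha.mean ha.integral_abs_le_one (hpos k) hk.le hpd
    calc _ ≤ |g p| := by
          by_cases hpX : p ∈ Xset (Euc n) <;> simp [hpX]
      _ ≤ _ := h1
      _ ≤ _ := by gcongr; linarith
  · filter_upwards [hsl] with t ht φ hφ hc
    exact ha.integral_limit_mul hg hpos he ht hφ hc

/-- The maximal regularity operator maps atoms to molecules of mean value zero. -/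
theorem exists_memH1 (ha : IsSourceAtom a c r) :
    ∃ g : ℝ × Euc n → ℝ, MemH1 volume ((Xset (Euc n)).indicator g) ∧
      H1norm volume ((Xset (Euc n)).indicator g) ≤ 4 * IsMolecule.molConst n * (decayConst n + 1) ∧
      ∀ᵐ t, ∀ φ : Euc n → ℝ, ContDiff ℝ 2 φ → HasCompactSupport φ →
        ∫ x, g (t, x) * φ x = ∫ q in {q | q.1 < t}, heatPairing t (lapl φ) q * a q := by
  obtain ⟨g, hmol, hg⟩ := ha.exists_limit_isMolecule
  have hi := hmol.integrable
  have h0 : ∫ p, (Xset (Euc n)).indicator g p ∂pmeas volume = 0 := by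
    rw [pmeas] at hi ⊢
    rw [integral_prod _ hi]
    refine integral_eq_zero_of_ae ?_
    filter_upwards [hi.prod_right_ae, hg] with t hti ht
    by_cases ht0 : 0 < t
    · have h1 : ∀ x, (Xset (Euc n)).indicator g (t, x) = g (t, x) := fun x =>
        indicator_of_mem (show (t, x) ∈ Xset (Euc n) from ht0) g
      simp_rw [h1] at hti ⊢
      exact ha.integral_eq_zero_of_forall_mul t hti ht
    · have h1 : ∀ x, (Xset (Euc n)).indicator g (t, x) = 0 := fun x =>
        indicator_of_notMem (show (t, x) ∉ Xset (Euc n) from ht0) g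
      simp [h1]
  exact ⟨g, (hmol.memH1 h0).1, (hmol.memH1 h0).2, hg⟩

end IsSourceAtom

/-- boundedness of the maximal regularity operator on `H¹_z`: there is `C`,
depending only on `n`, such that for every `(1,∞)`-atom `a` supported in a parabolic ball
`Q ⊆ X = (0,∞) × ℝⁿ`, with `u(t,x) = ∫_0^t ∫ p_{t−s}(x−y) a(s,y) dy ds`, there exists
`g ∈ H¹_z(X)` with `‖g‖_{H¹_z(X)} ≤ C` such that for a.e. `t > 0`, `g(t,·)` is the
distributional Laplacian in `x` of `u(t,·)`. -/
theorem stmt18 (n : ℕ) (hn : 1 ≤ n) :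
    ∃ C : ℝ, 0 < C ∧
      ∀ (a : ℝ × EuclideanSpace ℝ (Fin n) → ℝ)
        (c : ℝ × EuclideanSpace ℝ (Fin n)) (r : ℝ),
        IsAtom1Inf n a c r →
        ∃ g : ℝ × EuclideanSpace ℝ (Fin n) → ℝ,
          MemH1z (volume : Measure (EuclideanSpace ℝ (Fin n))) g ∧
          H1znorm (volume : Measure (EuclideanSpace ℝ (Fin n))) g ≤ C ∧
          ∀ᵐ t ∂(volume.restrict (Set.Ioi (0 : ℝ))),
            ∀ φ : EuclideanSpace ℝ (Fin n) → ℝ,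
              ContDiff ℝ (⊤ : ℕ∞) φ → HasCompactSupport φ →
              (∫ x, (∫ q in Set.Ioo (0 : ℝ) t ×ˢ
                      (Set.univ : Set (EuclideanSpace ℝ (Fin n))),
                    heatKernel n (t - q.1) (x - q.2) * a q ∂(pmeas volume)) *
                  lapl φ x) =
                ∫ x, g (t, x) * φ x := by
  have hC := decayConst_pos n
  have hK := IsMolecule.molConst_pos n
  refine ⟨4 * IsMolecule.molConst n * (decayConst n + 1), by positivity, fun a c r hatom => ?_⟩
  obtain ⟨b, hb, hab⟩ := hatom.exists_isSourceAtom
  obtain ⟨g, hg, hgn, hid⟩ := hb.exists_memH1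
  have hX : MeasurableSet (Xset (Euc n)) := measurableSet_lt measurable_const measurable_fst
  refine ⟨g, ⟨(integrable_indicator_iff hX).1 hg.1, hg⟩, hgn, ?_⟩
  filter_upwards [ae_restrict_of_ae hid] with t ht φ hφ hc
  have hφ2 : ContDiff ℝ 2 φ := contDiff_infty.1 hφ 2
  obtain ⟨L, hL⟩ := (hasCompactSupport_lapl hc).exists_bound_of_continuous (continuous_lapl hφ2)
  rw [ht φ hφ2 hc, ← hb.integral_duhamel_mul t (continuous_lapl hφ2).measurable hL]
  congr 1 with x
  congr 1
  refine integral_congr_ae (ae_restrict_of_ae ?_)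
  change ∀ᵐ q ∂(volume : Measure (ℝ × Euc n)), _
  filter_upwards [hab] with q hq
  rw [hq]
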